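/- (Dubrovin's spectral theorem for the quantum dispersionless KdV hierarchy.) For every partition λ and every integer m ≥ −1, the Schur polynomial s_λ(T) is an eigenvector of the quantum dispersionless KdV Hamiltonian K_m^{[0]}: K_m^{[0]} s_λ(T) = (Σ_{j=0}^{m+2} V_0^{m+2−j} Q_j(λ)/(m+2−j)!) · s_λ(T). -/

import Mathlib

open MvPolynomial

/-- A partition `λ = (λ_1, λ_2, …)`: a non-increasing sequence of non-negative
integers with finitely many nonzero parts.  `parts i` is the part `λ_{i+1}`. -/
structure Ptn where
  parts : ℕ → ℕ
  antitone : ∀ ⦃i j : ℕ⦄, i ≤ j → parts j ≤ parts i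
  eventually_zero : ∃ N : ℕ, ∀ i : ℕ, N ≤ i → parts i = 0

/-- The length `ℓ(λ)`: the number of nonzero parts. -/
noncomputable def Ptn.len (lam : Ptn) : ℕ := Set.ncard {i : ℕ | lam.parts i ≠ 0}

/-- `P_j(λ) = Σ_{i=1}^{ℓ(λ)} [(λ_i − i + 1/2)^j − (−i + 1/2)^j]`. -/
noncomputable def Pfn (j : ℕ) (lam : Ptn) : ℚ :=
  ∑ᶠ i : ℕ, (((lam.parts i : ℚ) - ((i : ℚ) + 1) + 1 / 2) ^ j - (-((i : ℚ) + 1) + 1 / 2) ^ j)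

/-- `Q_0(λ) = 1` and, for `j ≥ 1`, `Q_j(λ) = P_{j−1}(λ)/(j−1)! + β_j`, where
`β_j = (2^{1−j} − 1) B_j / j!` with `B_j` the `j`-th Bernoulli number. -/
noncomputable def Qfn (j : ℕ) (lam : Ptn) : ℚ :=
  if j = 0 then 1
  else Pfn (j - 1) lam / (Nat.factorial (j - 1) : ℚ) +
    ((2 : ℚ) ^ ((1 : ℤ) - (j : ℤ)) - 1) * bernoulli j / (Nat.factorial j : ℚ)

/-- The generating series `Σ_{k≥1} T_k z^k / k` (with `T_k = X k`). -/
noncomputable def genT : PowerSeries (MvPolynomial ℕ+ ℂ) :=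
  PowerSeries.mk fun m =>
    if h : m = 0 then 0 else ((m : ℂ)⁻¹) • (X (⟨m, Nat.pos_of_ne_zero h⟩ : ℕ+))

/-- The complete homogeneous polynomial `h_k(T)`, defined via
`Σ_{k≥0} h_k(T) z^k = exp(Σ_{k≥1} T_k z^k / k)`. -/
noncomputable def hsym (k : ℕ) : MvPolynomial ℕ+ ℂ :=
  ∑ n ∈ Finset.range (k + 1),
    ((Nat.factorial n : ℂ)⁻¹) • (PowerSeries.coeff k (genT ^ n))

/-- `h_k` for an integer index, with `h_k := 0` for `k < 0`. -/
noncomputable def hsymZ (z : ℤ) : MvPolynomial ℕ+ ℂ :=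
  if 0 ≤ z then hsym z.toNat else 0

/-- The Schur polynomial `s_λ = det(h_{λ_i−i+j})_{1≤i,j≤ℓ(λ)}` (Jacobi–Trudi). -/
noncomputable def schur (lam : Ptn) : MvPolynomial ℕ+ ℂ :=
  (Matrix.of fun i j : Fin lam.len =>
    hsymZ ((lam.parts i : ℤ) - ((i : ℕ) + 1) + ((j : ℕ) + 1))).det

/-- The operators `V̂_k` on `ℂ[T_1, T_2, …]`: multiplication by `T_k` for
`k > 0`, the scalar `V_0` for `k = 0`, and `−k ∂/∂T_{−k}` for `k < 0`. -/
noncomputable def Vhat (V0 : ℝ) (k : ℤ) :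
    MvPolynomial ℕ+ ℂ →ₗ[ℂ] MvPolynomial ℕ+ ℂ :=
  if hk : 0 < k then
    LinearMap.mulLeft ℂ (X (⟨k.toNat, by omega⟩ : ℕ+))
  else if hk0 : k = 0 then
    (V0 : ℂ) • LinearMap.id
  else
    (-(k : ℂ)) • (pderiv (⟨(-k).toNat, by omega⟩ : ℕ+)).toLinearMap

/-- The normally ordered product `:V̂_{k_1} ⋯ V̂_{k_n}:`: all factors with
`k_i ≥ 0` are composed to the left of (applied after) all factors with
`k_i < 0`. -/
noncomputable def normalOrdV (V0 : ℝ) (n : ℕ) (k : Fin n → ℤ) :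
    MvPolynomial ℕ+ ℂ →ₗ[ℂ] MvPolynomial ℕ+ ℂ :=
  ((List.ofFn fun i => if 0 ≤ k i then Vhat V0 (k i) else LinearMap.id).foldr
    (· ∘ₗ ·) LinearMap.id) ∘ₗ
  ((List.ofFn fun i => if k i < 0 then Vhat V0 (k i) else LinearMap.id).foldr
    (· ∘ₗ ·) LinearMap.id)

/-- The power series `S(z) = sinh(z/2)/(z/2) = Σ_j z^{2j} / (4^j (2j+1)!)`. -/
noncomputable def Sser : PowerSeries ℂ :=
  PowerSeries.mk fun n =>
    if Even n then ((2 ^ n * Nat.factorial (n + 1) : ℕ) : ℂ)⁻¹ else 0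

/-- The coefficient of `z^p` in `S(z)^{−1} (z^n/n!) ∏_{i=1}^n S(z k_i)`. -/
noncomputable def coefS (p n : ℕ) (k : Fin n → ℤ) : ℂ :=
  PowerSeries.coeff p
    (Sser⁻¹ * (PowerSeries.X ^ n * PowerSeries.C ((Nat.factorial n : ℂ)⁻¹)) *
      ∏ i : Fin n, PowerSeries.rescale ((k i : ℂ)) Sser)

/-- The quantum dispersionless KdV Hamiltonian `K_{p−2}^{[0]}` (`p ≥ 1`), i.e.
the coefficient of `z^p` in Eliashberg's generating series
`ℋ(z) = 1 + Σ_{m≥−1} z^{m+2} K_m^{[0]}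
      = S(z)^{−1} Σ_{n≥0} (z^n/n!) Σ_{k_1+⋯+k_n=0} (∏_i S(z k_i)) :V̂_{k_1}⋯V̂_{k_n}:`.
On any fixed polynomial only finitely many terms contribute, whence the
finitely supported sums `∑ᶠ`. -/
noncomputable def Kop (V0 : ℝ) (p : ℕ) (f : MvPolynomial ℕ+ ℂ) : MvPolynomial ℕ+ ℂ :=
  ∑ᶠ n : ℕ, ∑ᶠ k : Fin n → ℤ,
    if (∑ i, k i) = 0 then coefS p n k • normalOrdV V0 n k f else 0



noncomputable def eT {A : Type*} [CommRing A] [Algebra ℂ A] (M : ℕ) (x : A) : A :=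
  ∑ n ∈ Finset.range M, ((Nat.factorial n : ℂ)⁻¹) • x ^ n

theorem eT_add_aux {A : Type*} [CommRing A] [Algebra ℂ A] (x y : A) (n : ℕ) :
    ((Nat.factorial n : ℂ)⁻¹) • (x + y) ^ n =
      ∑ p ∈ Finset.HasAntidiagonal.antidiagonal n, (((Nat.factorial p.1 : ℂ)⁻¹) • x ^ p.1) *
        (((Nat.factorial p.2 : ℂ)⁻¹) • y ^ p.2) := by
  rw [(Commute.all x y).add_pow', Finset.smul_sum]
  refine Finset.sum_congr rfl fun p hp => ?_
  rw [Finset.HasAntidiagonal.mem_antidiagonal] at hp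
  subst hp
  rw [smul_mul_smul_comm, ← Nat.cast_smul_eq_nsmul ℂ, smul_smul]
  congr 1
  have h := Nat.add_choose_mul_factorial_mul_factorial p.1 p.2
  have h1 : ((Nat.choose (p.1+p.2) p.1 : ℕ) : ℂ) * (p.1.factorial : ℂ) * (p.2.factorial : ℂ) = ((p.1+p.2).factorial : ℂ) := by
    rw [Nat.choose_symm_add]
    exact_mod_cast h
  have a1 : (p.1.factorial : ℂ) ≠ 0 := by exact_mod_cast p.1.factorial_ne_zero
  have a2 : (p.2.factorial : ℂ) ≠ 0 := by exact_mod_cast p.2.factorial_ne_zero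
  have a3 : ((p.1+p.2).factorial : ℂ) ≠ 0 := by exact_mod_cast (p.1+p.2).factorial_ne_zero
  field_simp
  linear_combination h1

theorem eT_add {A : Type*} [CommRing A] [Algebra ℂ A] (t x y : A) (hx : t ∣ x) (hy : t ∣ y)
    (M : ℕ) : t ^ M ∣ eT M x * eT M y - eT M (x + y) := by
  have h1 : eT M (x + y) = ∑ p ∈ (Finset.range M ×ˢ Finset.range M).filter (fun p : ℕ × ℕ => p.1 + p.2 < M),
      (((Nat.factorial p.1 : ℂ)⁻¹) • x ^ p.1) * (((Nat.factorial p.2 : ℂ)⁻¹) • y ^ p.2) := by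
    rw [eT, ← Finset.sum_fiberwise_of_maps_to (t := Finset.range M) (g := fun p : ℕ × ℕ => p.1 + p.2)]
    · refine Finset.sum_congr rfl fun n hn => ?_
      rw [eT_add_aux]
      refine Finset.sum_congr ?_ fun _ _ => rfl
      ext p
      simp only [Finset.mem_range] at hn
      simp only [Finset.HasAntidiagonal.mem_antidiagonal, Finset.mem_filter, Finset.mem_product, Finset.mem_range]
      omega
    · intro p hp
      simp only [Finset.mem_filter] at hp
      simpa using hp.2
  have h2 : eT M x * eT M y = ∑ p ∈ (Finset.range M ×ˢ Finset.range M),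
      (((Nat.factorial p.1 : ℂ)⁻¹) • x ^ p.1) * (((Nat.factorial p.2 : ℂ)⁻¹) • y ^ p.2) := by
    rw [eT, eT, Finset.sum_mul_sum, Finset.sum_product]
  rw [h2, h1, ← Finset.sum_filter_add_sum_filter_not (Finset.range M ×ˢ Finset.range M) (fun p : ℕ × ℕ => p.1 + p.2 < M),
    add_sub_cancel_left]
  refine Finset.dvd_sum fun p hp => ?_
  simp only [Finset.mem_filter, not_lt] at hp
  rw [smul_mul_smul_comm]
  refine Dvd.dvd.trans ?_ (Dvd.intro_left (algebraMap ℂ A (((p.1.factorial:ℂ))⁻¹ * (p.2.factorial:ℂ)⁻¹)) (Algebra.smul_def _ _).symm)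
  refine (pow_dvd_pow t hp.2).trans ?_
  rw [pow_add]
  exact mul_dvd_mul (pow_dvd_pow_of_dvd hx _) (pow_dvd_pow_of_dvd hy _)

theorem eT_map {A A' : Type*} [CommRing A] [Algebra ℂ A] [CommRing A'] [Algebra ℂ A'] (φ : A →+* A')
    (h : ∀ (r : ℂ) (x : A), φ (r • x) = r • φ x) (M : ℕ) (x : A) : φ (eT M x) = eT M (φ x) := by
  simp [eT, h]

theorem eT_dvd {A : Type*} [CommRing A] [Algebra ℂ A] (t x y : A) (h : t ∣ x - y) (M : ℕ) :
    t ∣ eT M x - eT M y := by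
  rw [eT, eT, ← Finset.sum_sub_distrib]
  refine Finset.dvd_sum fun n _ => ?_
  rw [← smul_sub, Algebra.smul_def]
  exact Dvd.dvd.mul_left (h.trans (sub_dvd_pow_sub_pow x y n)) _

theorem eT_mono {A : Type*} [CommRing A] [Algebra ℂ A] (t x : A) (h : t ∣ x) {M M' : ℕ} (hM : M ≤ M') :
    t ^ M ∣ eT M' x - eT M x := by
  rw [eT, eT, ← Finset.sum_range_add_sum_Ico _ hM, add_sub_cancel_left]
  refine Finset.dvd_sum fun n hn => ?_
  rw [Algebra.smul_def]
  exact Dvd.dvd.mul_left ((pow_dvd_pow t (Finset.mem_Ico.1 hn).1).trans (pow_dvd_pow_of_dvd h _)) _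

theorem coeff_eq_of_dvd {A : Type*} [CommRing A] {M a : ℕ} {f g : PowerSeries A}
    (h : PowerSeries.X ^ M ∣ f - g) (ha : a < M) : PowerSeries.coeff a f = PowerSeries.coeff a g := by
  rw [PowerSeries.X_pow_dvd_iff] at h
  have := h a ha
  rw [map_sub] at this
  exact sub_eq_zero.1 this

noncomputable def eS {A : Type*} [CommRing A] [Algebra ℂ A] (f : PowerSeries A) : PowerSeries A :=
  PowerSeries.mk fun a => PowerSeries.coeff a (eT (a + 1) f)

theorem eS_dvd {A : Type*} [CommRing A] [Algebra ℂ A] (f : PowerSeries A)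
    (hf : PowerSeries.X ∣ f) (M : ℕ) : PowerSeries.X ^ M ∣ eT M f - eS f := by
  rw [PowerSeries.X_pow_dvd_iff]
  intro m hm
  rw [map_sub, eS, PowerSeries.coeff_mk, sub_eq_zero]
  exact coeff_eq_of_dvd (eT_mono _ _ hf (show m + 1 ≤ M from hm)) (Nat.lt_succ_self m)

theorem eS_coeff {A : Type*} [CommRing A] [Algebra ℂ A] (f : PowerSeries A)
    (hf : PowerSeries.X ∣ f) {M a : ℕ} (h : a < M) :
    PowerSeries.coeff a (eS f) = PowerSeries.coeff a (eT M f) :=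
  (coeff_eq_of_dvd (eS_dvd f hf M) h).symm

theorem eS_add {A : Type*} [CommRing A] [Algebra ℂ A] (f g : PowerSeries A)
    (hf : PowerSeries.X ∣ f) (hg : PowerSeries.X ∣ g) : eS (f + g) = eS f * eS g := by
  ext a
  have h1 := eS_dvd _ (dvd_add hf hg) (a + 1)
  have h2 := eS_dvd _ hf (a + 1)
  have h3 := eS_dvd _ hg (a + 1)
  have h4 := eT_add _ _ _ hf hg (a + 1)
  refine coeff_eq_of_dvd (M := a + 1) ?_ (Nat.lt_succ_self a)
  have : eS (f + g) - eS f * eS g = -(eT (a+1) (f+g) - eS (f+g)) - (eT (a+1) f * eT (a+1) g - eT (a+1) (f+g))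
      + (eT (a+1) f - eS f) * eT (a+1) g + eS f * (eT (a+1) g - eS g) := by ring
  rw [this]
  exact dvd_add (dvd_add (dvd_sub h1.neg_right h4) (h2.mul_right _)) (h3.mul_left _)

theorem eS_zero {A : Type*} [CommRing A] [Algebra ℂ A] : eS (0 : PowerSeries A) = 1 := by
  ext a
  rw [eS, PowerSeries.coeff_mk, eT, Finset.sum_range_succ']
  simp

theorem eS_sum {A ι : Type*} [CommRing A] [Algebra ℂ A] (s : Finset ι) (f : ι → PowerSeries A)
    (hf : ∀ i, PowerSeries.X ∣ f i) : eS (∑ i ∈ s, f i) = ∏ i ∈ s, eS (f i) := by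
  classical
  induction s using Finset.induction_on with
  | empty => simp [eS_zero]
  | insert a s ha ih =>
    rw [Finset.sum_insert ha, Finset.prod_insert ha, eS_add _ _ (hf a) (Finset.dvd_sum fun i _ => hf i), ih]

theorem eS_rescale {A : Type*} [CommRing A] [Algebra ℂ A] (f : PowerSeries A) (c : A) :
    eS (PowerSeries.rescale c f) = PowerSeries.rescale c (eS f) := by
  ext a
  rw [PowerSeries.coeff_rescale, eS, eS, PowerSeries.coeff_mk, PowerSeries.coeff_mk,
    ← PowerSeries.coeff_rescale, eT_map (PowerSeries.rescale c)]
  intro r x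
  ext n
  simp

theorem eS_map {A A' : Type*} [CommRing A] [Algebra ℂ A] [CommRing A'] [Algebra ℂ A'] (φ : A →+* A')
    (h : ∀ (r : ℂ) (x : A), φ (r • x) = r • φ x) (f : PowerSeries A) :
    eS (PowerSeries.map φ f) = PowerSeries.map φ (eS f) := by
  ext a
  rw [PowerSeries.coeff_map, eS, eS, PowerSeries.coeff_mk, PowerSeries.coeff_mk,
    ← PowerSeries.coeff_map, eT_map (PowerSeries.map φ)]
  intro r x
  ext n
  simp [h]

theorem X_dvd_rescale {A : Type*} [CommRing A] (f : PowerSeries A) (c : A) (h : PowerSeries.X ∣ f) :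
    PowerSeries.X ∣ PowerSeries.rescale c f := by
  rw [PowerSeries.X_dvd_iff, ← PowerSeries.coeff_zero_eq_constantCoeff_apply] at *
  simp [h]

theorem eS_deriv {A : Type*} [CommRing A] [Algebra ℂ A] (f : PowerSeries A)
    (hf : PowerSeries.X ∣ f) :
    PowerSeries.derivative A (eS f) = eS f * PowerSeries.derivative A f := by
  have key : ∀ M, PowerSeries.derivative A (eT (M+1) f) = eT M f * PowerSeries.derivative A f := by
    intro M
    rw [eT, eT, map_sum, Finset.sum_range_succ', Finset.sum_mul]
    simp only [pow_zero]
    have : PowerSeries.derivative A (((Nat.factorial 0 : ℂ)⁻¹) • (1 : PowerSeries A)) = 0 := by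
      simp [PowerSeries.derivative_one]
    rw [this, add_zero]
    refine Finset.sum_congr rfl fun n _ => ?_
    have h2 : (((n+1).factorial : ℂ)⁻¹) • f ^ (n+1) = (algebraMap ℂ A (((n+1).factorial : ℂ)⁻¹)) • f^(n+1) := by
      rw [algebraMap_smul]
    rw [h2, Derivation.map_smul, PowerSeries.derivative_pow, algebraMap_smul, Nat.add_sub_cancel,
      smul_mul_assoc, mul_assoc, ← nsmul_eq_mul, ← Nat.cast_smul_eq_nsmul ℂ, smul_smul]
    congr 1
    have h4 : (n : ℂ) + 1 ≠ 0 := by exact_mod_cast n.succ_ne_zero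
    have a1 : (n.factorial : ℂ) ≠ 0 := by exact_mod_cast n.factorial_ne_zero
    rw [Nat.factorial_succ]
    push_cast
    field_simp
  ext a
  rw [PowerSeries.coeff_derivative, eS_coeff f hf (show a + 1 < a + 1 + 1 by omega), ← PowerSeries.coeff_derivative, key]
  refine coeff_eq_of_dvd (M := a+1) ?_ (Nat.lt_succ_self a)
  rw [← sub_mul]
  exact (eS_dvd f hf _).mul_right _

noncomputable def ell (A : Type*) [CommRing A] [Algebra ℂ A] : PowerSeries A :=
  PowerSeries.mk fun k => algebraMap ℂ A ((k : ℂ)⁻¹)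

theorem X_dvd_ell (A : Type*) [CommRing A] [Algebra ℂ A] : PowerSeries.X ∣ ell A := by
  rw [PowerSeries.X_dvd_iff, ← PowerSeries.coeff_zero_eq_constantCoeff_apply, ell]
  simp

theorem eS_ell (A : Type*) [CommRing A] [Algebra ℂ A] :
    eS (ell A) * (1 - PowerSeries.X) = 1 := by
  have : IsAddTorsionFree A := by
    refine ⟨fun n hn a b h => ?_⟩
    have h1 : n • a = n • b := h
    rw [← Nat.cast_smul_eq_nsmul ℂ, ← Nat.cast_smul_eq_nsmul ℂ] at h1
    have h2 := congrArg (fun x => ((n : ℂ)⁻¹) • x) h1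
    simpa [smul_smul, inv_mul_cancel₀ (show (n : ℂ) ≠ 0 by exact_mod_cast hn)] using h2
  apply PowerSeries.derivative.ext
  · rw [Derivation.leibniz, eS_deriv _ (X_dvd_ell A)]
    have : (1 - PowerSeries.X) * PowerSeries.derivative A (ell A) = 1 := by
      have h0 : PowerSeries.derivative A (ell A) = PowerSeries.mk (1 : ℕ → A) := by
        ext n
        rw [PowerSeries.coeff_derivative, ell, PowerSeries.coeff_mk, PowerSeries.coeff_mk]
        have : ((n : A) + 1) = algebraMap ℂ A (n + 1) := by simp
        rw [this, ← map_mul]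
        have h : (n : ℂ) + 1 ≠ 0 := by exact_mod_cast n.succ_ne_zero
        rw [Nat.cast_succ, inv_mul_cancel₀ h]; simp
      rw [h0, mul_comm]
      exact PowerSeries.mk_one_mul_one_sub_eq_one A
    simp only [smul_eq_mul, map_sub, PowerSeries.derivative_one, PowerSeries.derivative_X]
    linear_combination (eS (ell A)) * this
  · simp only [map_mul, map_sub, map_one, PowerSeries.constantCoeff_X, sub_zero, mul_one]
    rw [← PowerSeries.coeff_zero_eq_constantCoeff_apply, eS, PowerSeries.coeff_mk]
    simp [eT]

theorem eS_ell_rescale (A : Type*) [CommRing A] [Algebra ℂ A] (c : A) :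
    eS (PowerSeries.rescale c (ell A)) * (1 - PowerSeries.C c * PowerSeries.X) = 1 := by
  have := congrArg (PowerSeries.rescale c) (eS_ell A)
  rw [map_mul, ← eS_rescale, map_sub, map_one, PowerSeries.rescale_X] at this
  exact this


noncomputable def vdm {S : Type*} [CommRing S] {N : ℕ} (y : Fin N → S) : S :=
  (Matrix.of fun i j : Fin N => y i ^ (N - 1 - (j : ℕ))).det

theorem vdm_eq {S : Type*} [CommRing S] {N : ℕ} (y : Fin N → S) :
    vdm y = ∏ i : Fin N, ∏ j ∈ Finset.Ioi i, (y i - y j) := by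
  have h := Matrix.det_projVandermonde (n := N) (fun _ => (1 : S)) y
  simp only [one_mul] at h
  rw [← h, vdm]
  congr 1
  ext i j
  rw [Matrix.projVandermonde_apply]
  simp only [Matrix.of_apply, one_pow, one_mul, Fin.val_rev]
  congr 1
  omega

theorem vdm_update {S : Type*} [CommRing S] {N : ℕ} (y : Fin N → S) (i : Fin N) :
    ∃ K, ∀ t, vdm (Function.update y i t) = K * ∏ j ∈ Finset.univ.erase i, (t - y j) := by
  refine ⟨(∏ a ∈ Finset.univ.erase i, ∏ b ∈ (Finset.Ioi a).erase i, (y a - y b)) *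
    ∏ j ∈ Finset.univ.erase i, (if j < i then (-1 : S) else 1), fun t => ?_⟩
  rw [vdm_eq, ← Finset.mul_prod_erase Finset.univ _ (Finset.mem_univ i)]
  have h1 : ∏ b ∈ Finset.Ioi i, (Function.update y i t i - Function.update y i t b) =
      ∏ b ∈ Finset.univ.erase i, (if b < i then 1 else t - y b) := by
    rw [← Finset.prod_subset (s₁ := Finset.Ioi i) (s₂ := Finset.univ.erase i)
      (f := fun b => if b < i then 1 else t - y b)]
    · refine Finset.prod_congr rfl fun b hb => ?_
      have hb := Finset.mem_Ioi.1 hb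
      rw [Function.update_self, Function.update_of_ne (ne_of_gt hb), if_neg (not_lt.2 hb.le)]
    · intro b hb
      exact Finset.mem_erase.2 ⟨ne_of_gt (Finset.mem_Ioi.1 hb), Finset.mem_univ _⟩
    · intro b hb hb2
      have := Finset.ne_of_mem_erase hb
      rw [Finset.mem_Ioi] at hb2
      rw [if_pos (by omega)]
  have h2 : ∀ a ∈ Finset.univ.erase i, ∏ b ∈ Finset.Ioi a, (Function.update y i t a - Function.update y i t b) =
      (∏ b ∈ (Finset.Ioi a).erase i, (y a - y b)) * (if a < i then y a - t else 1) := by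
    intro a ha
    have ha' := Finset.ne_of_mem_erase ha
    have h3 : ∏ b ∈ (Finset.Ioi a).erase i, (y a - y b) =
      ∏ b ∈ (Finset.Ioi a).erase i, (Function.update y i t a - Function.update y i t b) := by
      refine Finset.prod_congr rfl fun b hb => ?_
      rw [Function.update_of_ne ha', Function.update_of_ne (Finset.ne_of_mem_erase hb)]
    rw [h3]
    split_ifs with hai
    · rw [← Finset.prod_erase_mul _ _ (Finset.mem_Ioi.2 hai), Function.update_self, Function.update_of_ne ha']
    · rw [mul_one, Finset.erase_eq_of_notMem (by simpa using hai)]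
  rw [h1, Finset.prod_congr rfl h2, Finset.prod_mul_distrib, mul_left_comm, mul_assoc]
  congr 1
  rw [← Finset.prod_mul_distrib, ← Finset.prod_mul_distrib]
  refine Finset.prod_congr rfl fun j _ => ?_
  split_ifs <;> ring

theorem vdm_rel {S : Type*} [CommRing S] {N : ℕ} (y : Fin N → S) (i : Fin N) (t : S) :
    vdm (Function.update y i t) * ∏ j ∈ Finset.univ.erase i, (y i - y j) =
      vdm y * ∏ j ∈ Finset.univ.erase i, (t - y j) := by
  obtain ⟨K, hK⟩ := vdm_update y i
  have h := hK (y i)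
  rw [Function.update_eq_self] at h
  rw [hK, h]
  ring

theorem lag {S : Type*} [CommRing S] [IsDomain S] {N : ℕ} (s : Fin N → S) (hs : Function.Injective s)
    (h0 : ∀ i, s i ≠ 0) (q d : S) (c : Fin N → S)
    (hc : ∀ i, c i * ∏ j ∈ Finset.univ.erase i, (s i - s j) = d * ∏ j ∈ Finset.univ.erase i, (q * s i - s j))
    (y : S) :
    d * (∏ i, (q * y - s i) - ∏ i, (y - s i)) =
      (q - 1) * ∑ i, c i * (y * ∏ j ∈ Finset.univ.erase i, (y - s j)) := by
  let P : Polynomial S := Polynomial.C d * (∏ i, (Polynomial.C q * Polynomial.X - Polynomial.C (s i)) -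
    ∏ i, (Polynomial.X - Polynomial.C (s i)))
  let Q : Polynomial S := Polynomial.C (q - 1) * ∑ i, Polynomial.C (c i) * (Polynomial.X *
    ∏ j ∈ Finset.univ.erase i, (Polynomial.X - Polynomial.C (s j)))
  have eP : ∀ y, P.eval y = d * (∏ i, (q * y - s i) - ∏ i, (y - s i)) := by
    intro y; simp [P, Polynomial.eval_prod]
  have eQ : ∀ y, Q.eval y = (q - 1) * ∑ i, c i * (y * ∏ j ∈ Finset.univ.erase i, (y - s j)) := by
    intro y; simp [Q, Polynomial.eval_prod, Polynomial.eval_finsetSum]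
  rw [← eP, ← eQ]
  congr 1
  let v : Option (Fin N) → S := fun o => o.elim 0 s
  have hd1 : ∀ (a : S) (t : Finset (Fin N)), (∏ i ∈ t, (Polynomial.C a * Polynomial.X - Polynomial.C (s i))).natDegree ≤ t.card := by
    intro a t
    refine (Polynomial.natDegree_prod_le _ _).trans ?_
    rw [Finset.card_eq_sum_ones]
    refine Finset.sum_le_sum fun i _ => ?_
    compute_degree
  have hd2 : ∀ (t : Finset (Fin N)), (∏ i ∈ t, (Polynomial.X - Polynomial.C (s i))).natDegree ≤ t.card := by
    intro t
    simp
  refine Polynomial.eq_of_degrees_lt_of_eval_index_eq (s := (Finset.univ : Finset (Option (Fin N)))) (v := v) ?_ ?_ ?_ ?_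
  · intro a _ b _ hab
    rcases a with _ | a <;> rcases b with _ | b
    · rfl
    · exact absurd hab.symm (h0 b)
    · exact absurd hab (h0 a)
    · exact congrArg some (hs hab)
  · refine lt_of_le_of_lt Polynomial.degree_le_natDegree ?_
    have : P.natDegree ≤ N := by
      refine (Polynomial.natDegree_C_mul_le _ _).trans ((Polynomial.natDegree_sub_le _ _).trans (max_le ?_ ?_))
      · simpa using hd1 q Finset.univ
      · simp
    simp only [Finset.card_univ, Fintype.card_option, Fintype.card_fin]
    exact_mod_cast Nat.lt_succ_of_le this
  · refine lt_of_le_of_lt Polynomial.degree_le_natDegree ?_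
    have : Q.natDegree ≤ N := by
      refine (Polynomial.natDegree_C_mul_le _ _).trans (Polynomial.natDegree_sum_le_of_forall_le _ _ fun i _ => ?_)
      refine (Polynomial.natDegree_C_mul_le _ _).trans (Polynomial.natDegree_mul_le.trans ?_)
      have h3 := hd2 (Finset.univ.erase i)
      rw [Finset.card_erase_of_mem (Finset.mem_univ i), Finset.card_univ, Fintype.card_fin] at h3
      have := i.2
      have h4 : (Polynomial.X : Polynomial S).natDegree ≤ 1 := Polynomial.natDegree_X_le
      omega
    simp only [Finset.card_univ, Fintype.card_option, Fintype.card_fin]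
    exact_mod_cast Nat.lt_succ_of_le this
  · intro o _
    rw [eP, eQ]
    rcases o with _ | i
    · simp [v]
    · simp only [v, Option.elim_some]
      rw [Finset.prod_eq_zero (f := fun j => s i - s j) (Finset.mem_univ i) (sub_self _), sub_zero,
        ← Finset.mul_prod_erase Finset.univ _ (Finset.mem_univ i),
        Finset.sum_eq_single i]
      · linear_combination (1 - q) * s i * hc i
      · intro j _ hj
        rw [Finset.prod_eq_zero (f := fun j => s i - s j) (Finset.mem_erase.2 ⟨hj.symm, Finset.mem_univ i⟩) (sub_self _)]
        simp
      · intro h; exact absurd (Finset.mem_univ i) h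

/-- generating identity. -/
theorem gen_id {A : Type*} [CommRing A] [IsDomain A] {N : ℕ} (x : Fin N → A) (hx : Function.Injective x)
    (h0 : ∀ i, x i ≠ 0) (r r' : A) (hr : r * r' = 1) (F : PowerSeries A)
    (hF : F * ∏ i, (1 - PowerSeries.C (r * x i) * PowerSeries.X) =
      ∏ i, (1 - PowerSeries.C (r' * x i) * PowerSeries.X)) (a : ℕ) :
    r ^ (2 * N) * (vdm x * PowerSeries.coeff a F) = (if a = 0 then vdm x else 0) +
      (r ^ 2 - 1) * ∑ i, (r ^ a * (x i ^ a * vdm (Function.update x i (r ^ 2 * x i)))) := by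
  have hr0 : r ≠ 0 := left_ne_zero_of_mul_eq_one hr
  let s : Fin N → PowerSeries A := fun i => PowerSeries.C (r * x i) * PowerSeries.X
  have hCX : Function.Injective fun u : A => PowerSeries.C u * (PowerSeries.X : PowerSeries A) := by
    intro u v h
    have := congrArg (PowerSeries.coeff 1) h
    simpa using this
  have hs : Function.Injective s := by
    intro i j h
    exact hx (mul_left_cancel₀ hr0 (hCX h))
  have hs0 : ∀ i, s i ≠ 0 := by
    intro i h
    have := hCX (a₁ := r * x i) (a₂ := 0) (by
      simp only [map_zero, zero_mul]; exact h)
    exact mul_ne_zero hr0 (h0 i) this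
  have L := lag s hs hs0 (PowerSeries.C (r^2)) (PowerSeries.C (vdm x))
    (fun i => PowerSeries.C (vdm (Function.update x i (r ^ 2 * x i)))) ?_ 1
  swap
  · intro i
    have e1 : ∏ j ∈ Finset.univ.erase i, (s i - s j) =
      PowerSeries.C (∏ j ∈ Finset.univ.erase i, (x i - x j)) * ∏ j ∈ Finset.univ.erase i, (PowerSeries.C r * PowerSeries.X) := by
      rw [map_prod, ← Finset.prod_mul_distrib]
      refine Finset.prod_congr rfl fun j _ => ?_
      simp only [s, map_mul, map_sub]; ring
    have e2 : ∏ j ∈ Finset.univ.erase i, (PowerSeries.C (r^2) * s i - s j) =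
      PowerSeries.C (∏ j ∈ Finset.univ.erase i, (r^2 * x i - x j)) * ∏ j ∈ Finset.univ.erase i, (PowerSeries.C r * PowerSeries.X) := by
      rw [map_prod, ← Finset.prod_mul_distrib]
      refine Finset.prod_congr rfl fun j _ => ?_
      simp only [s, map_mul, map_sub]; ring
    rw [e1, e2, ← mul_assoc, ← mul_assoc, ← map_mul, ← map_mul, vdm_rel]
  set D : PowerSeries A := ∏ i, (1 - s i) with hD
  have hne : ∀ i, (1 - s i) ≠ 0 := by
    intro i h
    have := congrArg (PowerSeries.constantCoeff) h
    simp [s] at this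
  have hD0 : D ≠ 0 := Finset.prod_ne_zero_iff.2 fun i _ => hne i
  let Gm : Fin N → PowerSeries A := fun i => PowerSeries.rescale (r * x i) (PowerSeries.mk 1)
  have hG : ∀ i, Gm i * (1 - s i) = 1 := by
    intro i
    have := congrArg (PowerSeries.rescale (r * x i)) (PowerSeries.mk_one_mul_one_sub_eq_one A)
    rw [map_mul, map_sub, map_one, PowerSeries.rescale_X] at this
    exact this
  have e3 : ∏ i, (PowerSeries.C (r^2) * 1 - s i) = PowerSeries.C (r ^ (2*N)) * (F * D) := by
    have : F * D = ∏ i, (1 - PowerSeries.C (r' * x i) * PowerSeries.X) := hF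
    have h2 : PowerSeries.C (r ^ (2*N)) = ∏ _i : Fin N, PowerSeries.C (r^2) := by
      rw [Finset.prod_const, Finset.card_univ, Fintype.card_fin, pow_mul, map_pow]
    rw [this, h2, ← Finset.prod_mul_distrib]
    refine Finset.prod_congr rfl fun j _ => ?_
    have : PowerSeries.C r * PowerSeries.C r' = (1 : PowerSeries A) := by rw [← map_mul, hr, map_one]
    simp only [s, map_mul, map_pow]
    linear_combination (PowerSeries.C r * PowerSeries.C (x j) * PowerSeries.X) * this
  have e4 : ∀ i, (1 * ∏ j ∈ Finset.univ.erase i, (1 - s j)) = Gm i * D := by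
    intro i
    rw [hD, ← Finset.mul_prod_erase Finset.univ _ (Finset.mem_univ i), ← mul_assoc, hG]
  have key : PowerSeries.C (r ^ (2*N)) * (PowerSeries.C (vdm x) * F) = PowerSeries.C (vdm x) +
      PowerSeries.C (r^2 - 1) * ∑ i, PowerSeries.C (vdm (Function.update x i (r ^ 2 * x i))) * Gm i := by
    apply mul_right_cancel₀ hD0
    rw [e3] at L
    simp_rw [e4] at L
    have e5 : (∑ i, PowerSeries.C (vdm (Function.update x i (r ^ 2 * x i))) * Gm i) * D =
      ∑ i, PowerSeries.C (vdm (Function.update x i (r ^ 2 * x i))) * (Gm i * D) := by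
      rw [Finset.sum_mul]; simp_rw [mul_assoc]
    rw [add_mul, mul_assoc (PowerSeries.C (r^2-1)), e5, map_sub, map_one]
    linear_combination L
  have := congrArg (PowerSeries.coeff a) key
  rw [PowerSeries.coeff_C_mul, PowerSeries.coeff_C_mul, map_add, PowerSeries.coeff_C_mul, map_sum,
    PowerSeries.coeff_C] at this
  rw [this]
  congr 2
  refine Finset.sum_congr rfl fun i _ => ?_
  rw [PowerSeries.coeff_C_mul]
  simp only [Gm, PowerSeries.coeff_rescale, PowerSeries.coeff_mk, Pi.one_apply]
  ring


abbrev RR := MvPolynomial ℕ+ ℂ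
abbrev BB := PowerSeries RR
abbrev AA (N : ℕ) := MvPolynomial (Fin N) BB

noncomputable def hh {N : ℕ} (α : Fin N → ℕ) (β : Fin N →₀ ℕ) : RR :=
  ∏ i, hsymZ ((α i : ℤ) - (β i : ℤ))

noncomputable def L0 {N : ℕ} (α : Fin N → ℕ) : MvPolynomial (Fin N) ℂ →ₗ[ℂ] RR :=
  (basisMonomials (Fin N) ℂ).constr ℂ (hh α)

noncomputable def LL {N : ℕ} (α : Fin N → ℕ) : AA N →ₗ[BB] BB :=
  (basisMonomials (Fin N) BB).constr BB (fun β => PowerSeries.C (hh α β))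

theorem L0_monomial {N : ℕ} (α : Fin N → ℕ) (β : Fin N →₀ ℕ) (r : ℂ) :
    L0 α (monomial β r) = r • hh α β := by
  have : monomial β r = r • basisMonomials (Fin N) ℂ β := by
    simp [smul_monomial]
  rw [this, map_smul, L0, Module.Basis.constr_basis]

theorem LL_monomial {N : ℕ} (α : Fin N → ℕ) (β : Fin N →₀ ℕ) (r : BB) :
    LL α (monomial β r) = r * PowerSeries.C (hh α β) := by
  have : monomial β r = r • basisMonomials (Fin N) BB β := by
    simp [smul_monomial]
  rw [this, map_smul, LL, Module.Basis.constr_basis, smul_eq_mul]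

noncomputable def cB : ℂ →+* BB := (PowerSeries.C).comp (MvPolynomial.C)

theorem cB_mul (r : ℂ) (x : BB) : cB r * x = r • x := by
  rw [Algebra.smul_def, PowerSeries.algebraMap_apply]
  rfl

theorem LL_map {N : ℕ} (α : Fin N → ℕ) (P : MvPolynomial (Fin N) ℂ) :
    LL α (MvPolynomial.map cB P) = PowerSeries.C (L0 α P) := by
  induction P using MvPolynomial.induction_on' with
  | monomial u a =>
    rw [map_monomial, LL_monomial, L0_monomial, cB, RingHom.comp_apply, ← map_mul, MvPolynomial.smul_eq_C_mul]
  | add p q hp hq => rw [map_add, map_add, map_add, map_add, hp, hq]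

theorem hsymZ_neg {n : ℤ} (h : n < 0) : hsymZ n = 0 := if_neg (not_le.2 h)
theorem hsymZ_nat (n : ℕ) : hsymZ n = hsym n := by simp [hsymZ]

theorem X_dvd_genT : PowerSeries.X ∣ genT := by
  rw [PowerSeries.X_dvd_iff, ← PowerSeries.coeff_zero_eq_constantCoeff_apply, genT]
  simp

theorem hsym_eq (n : ℕ) : hsym n = PowerSeries.coeff n (eS genT) := by
  rw [eS, PowerSeries.coeff_mk, eT, map_sum, hsym]
  rfl

/-- coefficientwise derivation -/
noncomputable def dser (D : Derivation ℂ RR RR) (f : PowerSeries RR) : PowerSeries RR :=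
  PowerSeries.mk fun n => D (PowerSeries.coeff n f)

theorem dser_mul (D : Derivation ℂ RR RR) (f g : PowerSeries RR) :
    dser D (f * g) = f * dser D g + g * dser D f := by
  ext1 n
  rw [dser, PowerSeries.coeff_mk, PowerSeries.coeff_mul, map_sum, map_add, mul_comm g,
    PowerSeries.coeff_mul, PowerSeries.coeff_mul, ← Finset.sum_add_distrib]
  refine Finset.sum_congr rfl fun p _ => ?_
  rw [Derivation.leibniz, dser, dser, PowerSeries.coeff_mk, PowerSeries.coeff_mk]
  simp only [smul_eq_mul]
  ring

theorem dser_pow (D : Derivation ℂ RR RR) (f : PowerSeries RR) (n : ℕ) :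
    dser D (f ^ (n+1)) = ((n + 1 : ℕ) : ℂ) • (f ^ n * dser D f) := by
  induction n with
  | zero => simp
  | succ n ih =>
    rw [pow_succ, dser_mul, ih]
    have : ((n + 1 + 1 : ℕ) : ℂ) = ((n+1 : ℕ) : ℂ) + 1 := by push_cast; ring
    rw [this, add_smul, one_smul, mul_smul_comm]
    rw [add_comm]
    congr 2
    ring

theorem coeff_genT (k : ℕ+) : PowerSeries.coeff (k : ℕ) genT = (((k : ℕ) : ℂ)⁻¹) • (X k : RR) := by
  rw [genT, PowerSeries.coeff_mk, dif_neg k.pos.ne']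
  rfl

theorem coeff_genT_zero : PowerSeries.coeff 0 genT = 0 := by
  rw [genT, PowerSeries.coeff_mk, dif_pos rfl]

theorem dser_genT (k : ℕ+) : dser ((k : ℂ) • pderiv k) genT = PowerSeries.X ^ (k : ℕ) := by
  ext1 n
  rw [dser, PowerSeries.coeff_mk, PowerSeries.coeff_X_pow]
  rw [Derivation.smul_apply]
  rcases Nat.eq_zero_or_pos n with hn | hn
  · subst hn
    have := k.pos
    rw [if_neg (by omega), coeff_genT_zero]
    simp
  · obtain ⟨j, rfl⟩ : ∃ j : ℕ+, n = j := ⟨⟨n, hn⟩, rfl⟩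
    rw [coeff_genT, Derivation.map_smul, pderiv_X]
    by_cases h : j = k
    · subst h
      rw [if_pos rfl, Pi.single_eq_same, smul_smul, mul_inv_cancel₀ (by exact_mod_cast hn.ne'), one_smul]
    · rw [if_neg (by exact_mod_cast h), Pi.single_eq_of_ne h]
      simp

theorem hsymZ_deriv (k : ℕ+) (n : ℤ) : ((k : ℂ) • pderiv k) (hsymZ n) = hsymZ (n - (k : ℕ)) := by
  rcases lt_or_ge n 0 with h | h
  · rw [hsymZ_neg h, hsymZ_neg (by omega), map_zero]
  · obtain ⟨n, rfl⟩ := Int.eq_ofNat_of_zero_le h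
    rw [hsymZ_nat, hsym, Finset.sum_range_succ', map_add, map_sum]
    have h1 : ∀ j, ((k : ℂ) • pderiv k) (((j+1).factorial : ℂ)⁻¹ • PowerSeries.coeff n (genT ^ (j+1))) =
        ((j.factorial : ℂ)⁻¹) • PowerSeries.coeff n (genT ^ j * PowerSeries.X ^ (k:ℕ)) := by
      intro j
      have := congrArg (PowerSeries.coeff n) (dser_pow ((k : ℂ) • pderiv k) genT j)
      rw [dser_genT, dser, PowerSeries.coeff_mk] at this
      rw [Derivation.map_smul, this]
      have h2 : PowerSeries.coeff n (((j+1 : ℕ) : ℂ) • (genT ^ j * PowerSeries.X ^ (k:ℕ))) =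
        ((j+1 : ℕ) : ℂ) • PowerSeries.coeff n (genT ^ j * PowerSeries.X ^ (k:ℕ)) := rfl
      rw [h2, smul_smul]
      congr 1
      have h4 : (j : ℂ) + 1 ≠ 0 := by exact_mod_cast j.succ_ne_zero
      have a1 : (j.factorial : ℂ) ≠ 0 := by exact_mod_cast j.factorial_ne_zero
      rw [Nat.factorial_succ]
      push_cast
      field_simp
    rw [Finset.sum_congr rfl fun j _ => h1 j]
    have h3 : ((k : ℂ) • pderiv k) (((Nat.factorial 0 : ℕ) : ℂ)⁻¹ • PowerSeries.coeff n (genT ^ 0)) = 0 := by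
      rw [Derivation.map_smul, pow_zero, PowerSeries.coeff_one]
      split_ifs <;> simp
    rw [h3, add_zero]
    have hk := k.pos
    rcases lt_or_ge n (k:ℕ) with h5 | h5
    · rw [hsymZ_neg (by omega)]
      refine Finset.sum_eq_zero fun j _ => ?_
      rw [PowerSeries.coeff_mul_X_pow', if_neg (by omega), smul_zero]
    · have : ((n : ℤ) - (k : ℕ)) = ((n - (k:ℕ) : ℕ) : ℤ) := by omega
      rw [this, hsymZ_nat, hsym_eq, eS_coeff _ X_dvd_genT (show n - (k:ℕ) < n by omega), eT, map_sum]
      refine Finset.sum_congr rfl fun j _ => ?_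
      rw [PowerSeries.coeff_mul_X_pow', if_pos h5]
      rfl

theorem deriv_prod {ι : Type*} [DecidableEq ι] (D : Derivation ℂ RR RR) (s : Finset ι) (f : ι → RR) :
    D (∏ i ∈ s, f i) = ∑ i ∈ s, D (f i) * ∏ j ∈ s.erase i, f j := by
  induction s using Finset.induction_on with
  | empty => simp
  | insert a s ha ih =>
    rw [Finset.prod_insert ha, Derivation.leibniz, ih, Finset.sum_insert ha, Finset.erase_insert ha,
      smul_eq_mul, smul_eq_mul, Finset.mul_sum, add_comm, mul_comm]
    congr 1
    refine Finset.sum_congr rfl fun i hi => ?_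
    have : i ≠ a := fun h => ha (h ▸ hi)
    rw [Finset.erase_insert_of_ne this.symm, Finset.prod_insert (by simp [ha])]
    ring

theorem hh_deriv {N : ℕ} (α : Fin N → ℕ) (β : Fin N →₀ ℕ) (k : ℕ+) :
    ((k : ℂ) • pderiv k) (hh α β) = ∑ i, hh α (Finsupp.single i (k:ℕ) + β) := by
  rw [hh, deriv_prod]
  refine Finset.sum_congr rfl fun i _ => ?_
  rw [hh, ← Finset.mul_prod_erase Finset.univ _ (Finset.mem_univ i), hsymZ_deriv]
  congr 1
  · congr 1
    simp
    ring
  · refine Finset.prod_congr rfl fun j hj => ?_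
    rw [Finsupp.add_apply, Finsupp.single_eq_of_ne (Finset.ne_of_mem_erase hj), zero_add]

theorem L0_deriv {N : ℕ} (α : Fin N → ℕ) (k : ℕ+) (P : MvPolynomial (Fin N) ℂ) :
    (k : ℂ) • pderiv k (L0 α P) = L0 α ((∑ i, X i ^ (k:ℕ)) * P) := by
  rw [← Derivation.smul_apply]
  induction P using MvPolynomial.induction_on' with
  | monomial u a =>
    rw [L0_monomial, Derivation.map_smul, hh_deriv, Finset.sum_mul, map_sum, Finset.smul_sum]
    refine Finset.sum_congr rfl fun i _ => ?_
    rw [X_pow_eq_monomial, monomial_mul, one_mul, L0_monomial]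
  | add p q hp hq => rw [map_add, map_add, mul_add, map_add, hp, hq]

theorem LL_vanish {N : ℕ} (α : Fin N → ℕ) (P Q : AA N) (d : ℕ) (hP : P.IsHomogeneous d)
    (hd : ∑ i, α i < d) : LL α (P * Q) = 0 := by
  induction Q using MvPolynomial.induction_on' with
  | add p q hp hq => rw [mul_add, map_add, hp, hq, add_zero]
  | monomial u a =>
    rw [P.as_sum, Finset.sum_mul, map_sum]
    refine Finset.sum_eq_zero fun m hm => ?_
    rw [monomial_mul, LL_monomial]
    have h1 : ∑ i, m i = d := by
      have := hP (mem_support_iff.1 hm)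
      rw [← this, Finsupp.weight_apply, Finsupp.sum_fintype]
      · simp
      · simp
    obtain ⟨i, hi⟩ : ∃ i, α i < m i := by
      by_contra hcon
      push Not at hcon
      have := Finset.sum_le_sum fun i (_ : i ∈ Finset.univ) => hcon i
      omega
    rw [hh, Finset.prod_eq_zero (Finset.mem_univ i), map_zero, mul_zero]
    apply hsymZ_neg
    simp only [Finsupp.add_apply]
    push_cast
    omega

theorem L0_schur (lam : Ptn) (α : Fin lam.len → ℕ)
    (hα : ∀ i, α i = lam.parts i + (lam.len - 1 - (i : ℕ))) :
    L0 α (vdm X) = schur lam := by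
  rw [vdm, schur, ← Matrix.det_transpose, ← Matrix.det_transpose (Matrix.of _), Matrix.det_apply, Matrix.det_apply, map_sum]
  refine Finset.sum_congr rfl fun σ _ => ?_
  rw [Units.smul_def, Units.smul_def, map_zsmul]
  congr 1
  simp only [Matrix.transpose_apply, Matrix.of_apply]
  have : ∏ i, (X i : MvPolynomial (Fin lam.len) ℂ) ^ (lam.len - 1 - ((σ i : Fin _) : ℕ)) =
      monomial (Finsupp.equivFunOnFinite.symm fun i => lam.len - 1 - ((σ i : Fin _) : ℕ)) 1 := by
    rw [monomial_eq]
    simp [Finsupp.prod_fintype]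
  rw [this, L0_monomial, one_smul, hh]
  refine Finset.prod_congr rfl fun i _ => ?_
  congr 1
  rw [hα]
  simp only [Finsupp.equivFunOnFinite_symm_apply_apply]
  have := i.2
  have := (σ i).2
  omega


noncomputable def ee (c : ℂ) : PowerSeries ℂ := PowerSeries.rescale c (PowerSeries.exp ℂ)

theorem ee_add (a b : ℂ) : ee a * ee b = ee (a + b) := PowerSeries.exp_mul_exp_eq_exp_add a b

theorem ee_coeff (c : ℂ) (n : ℕ) : PowerSeries.coeff n (ee c) = c ^ n * ((n.factorial : ℂ)⁻¹) := by
  rw [ee, PowerSeries.coeff_rescale, PowerSeries.coeff_exp]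
  simp

theorem ee_zero : ee 0 = 1 := by
  simp [ee]

theorem ee_pow (c : ℂ) (n : ℕ) : ee c ^ n = ee (n * c) := by
  induction n with
  | zero => simp [ee_zero]
  | succ n ih => rw [pow_succ, ih, ee_add]; congr 1; push_cast; ring

theorem zS (k : ℂ) (hk : k ≠ 0) : PowerSeries.X * PowerSeries.rescale k Sser =
    k⁻¹ • (ee (k * (1/2)) - ee (k * (-1/2))) := by
  ext n
  rw [PowerSeries.coeff_smul, map_sub, ee_coeff, ee_coeff]
  rcases n with _ | n
  · simp
  · rw [PowerSeries.coeff_succ_X_mul, PowerSeries.coeff_rescale, Sser, PowerSeries.coeff_mk]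
    have a1 : ((n+1).factorial : ℂ) ≠ 0 := by exact_mod_cast (n+1).factorial_ne_zero
    have h2 : (2:ℂ) ^ n ≠ 0 := pow_ne_zero _ two_ne_zero
    have e1 : (k * (-1/2)) ^ (n+1) = (-1)^(n+1) * (k * (1/2))^(n+1) := by
      rw [← mul_pow]; congr 1; ring
    have e2 : (k * (1/2)) ^ (n+1) = k^n * k * ((2^n)⁻¹ * (1/2)) := by
      rw [mul_pow, pow_succ, pow_succ (1/2 : ℂ) n, one_div, inv_pow]
    rw [e1, e2, smul_eq_mul]
    split_ifs with h
    · rw [pow_succ, h.neg_one_pow]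
      push_cast
      field_simp
      ring
    · rw [Nat.not_even_iff_odd] at h
      rw [pow_succ (-1 : ℂ), h.neg_one_pow]
      ring

noncomputable def io : PowerSeries ℂ →+* BB := PowerSeries.map (MvPolynomial.C)

noncomputable def rho : BB := io (ee (1/2))
noncomputable def rho' : BB := io (ee (-1/2))

theorem rho_mul : rho * rho' = 1 := by
  rw [rho, rho', ← map_mul, ee_add]
  have : (1/2 + -1/2 : ℂ) = 0 := by norm_num
  rw [this, ee_zero, map_one]

theorem io_smul (r : ℂ) (x : PowerSeries ℂ) : io (r • x) = r • io x := by
  ext1 n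
  rw [PowerSeries.coeff_smul, io, PowerSeries.coeff_map, PowerSeries.coeff_map, PowerSeries.coeff_smul]
  simp [MvPolynomial.smul_eq_C_mul]

theorem io_zS (k : ℕ) (hk : k ≠ 0) : io (PowerSeries.X * PowerSeries.rescale (k:ℂ) Sser) =
    (k:ℂ)⁻¹ • (rho ^ k - rho' ^ k) := by
  rw [zS _ (by exact_mod_cast hk), io_smul, rho, rho', ← map_pow, ← map_pow, ee_pow, ee_pow, map_sub]

theorem Sser_neg (k : ℂ) : PowerSeries.rescale (-k) Sser = PowerSeries.rescale k Sser := by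
  ext n
  rw [PowerSeries.coeff_rescale, PowerSeries.coeff_rescale, Sser, PowerSeries.coeff_mk]
  split_ifs with h
  · rw [h.neg_pow]
  · simp

noncomputable def Tg : PowerSeries BB := PowerSeries.map (PowerSeries.C) genT

theorem X_dvd_Tg : PowerSeries.X ∣ Tg := by
  rw [PowerSeries.X_dvd_iff, ← PowerSeries.coeff_zero_eq_constantCoeff_apply, Tg, PowerSeries.coeff_map,
    coeff_genT_zero, map_zero]

noncomputable def gam : PowerSeries BB := PowerSeries.rescale rho Tg - PowerSeries.rescale rho' Tg

theorem X_dvd_gam : PowerSeries.X ∣ gam :=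
  dvd_sub (X_dvd_rescale _ _ X_dvd_Tg) (X_dvd_rescale _ _ X_dvd_Tg)

noncomputable def phi (N : ℕ) : PowerSeries (AA N) :=
  ∑ i : Fin N, (PowerSeries.rescale (C rho * X i) (ell (AA N)) - PowerSeries.rescale (C rho' * X i) (ell (AA N)))

theorem X_dvd_phi (N : ℕ) : PowerSeries.X ∣ phi N :=
  Finset.dvd_sum fun _ _ => dvd_sub (X_dvd_rescale _ _ (X_dvd_ell _)) (X_dvd_rescale _ _ (X_dvd_ell _))

theorem eS_gam : eS gam * PowerSeries.rescale rho' (eS Tg) = PowerSeries.rescale rho (eS Tg) := by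
  rw [← eS_rescale, ← eS_rescale, ← eS_add _ _ X_dvd_gam (X_dvd_rescale _ _ X_dvd_Tg), gam, sub_add_cancel]

theorem eS_Tg_coeff (n : ℕ) : PowerSeries.coeff n (eS Tg) = PowerSeries.C (hsym n) := by
  rw [Tg, eS_map, PowerSeries.coeff_map, ← hsym_eq]
  intro r x
  rw [MvPolynomial.smul_eq_C_mul, map_mul]
  exact cB_mul r _

theorem eS_phi (N : ℕ) : eS (phi N) * ∏ i, (1 - PowerSeries.C (C rho * X i) * PowerSeries.X) =
    ∏ i, (1 - PowerSeries.C (C rho' * X i) * PowerSeries.X) := by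
  rw [phi, eS_sum _ _ fun i => dvd_sub (X_dvd_rescale _ _ (X_dvd_ell _)) (X_dvd_rescale _ _ (X_dvd_ell _)),
    ← Finset.prod_mul_distrib]
  refine Finset.prod_congr rfl fun i _ => ?_
  set f := PowerSeries.rescale (C rho * X i) (ell (AA N))
  set g := PowerSeries.rescale (C rho' * X i) (ell (AA N))
  have h1 : eS f * _ = 1 := eS_ell_rescale (AA N) (C rho * X i)
  have h2 : eS g * _ = 1 := eS_ell_rescale (AA N) (C rho' * X i)
  have hf : PowerSeries.X ∣ f := X_dvd_rescale _ _ (X_dvd_ell _)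
  have hg : PowerSeries.X ∣ g := X_dvd_rescale _ _ (X_dvd_ell _)
  have h3 : eS (f - g) * eS g = eS f := by
    rw [← eS_add _ _ (dvd_sub hf hg) hg, sub_add_cancel]
  generalize (1 - PowerSeries.C (C rho * X i) * PowerSeries.X : PowerSeries (AA N)) = u at *
  generalize (1 - PowerSeries.C (C rho' * X i) * PowerSeries.X : PowerSeries (AA N)) = v at *
  linear_combination (u * v) * h3 - eS (f-g) * u * h2 + v * h1

noncomputable def tt (V0 : ℝ) (k : ℤ) : RR :=
  if h : 0 < k then X (⟨k.toNat, by omega⟩ : ℕ+) else if k = 0 then C (V0 : ℂ) else 1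

noncomputable def uu (N : ℕ) (k : ℤ) : MvPolynomial (Fin N) ℂ :=
  if k < 0 then ∑ i, X i ^ (-k).toNat else 1

noncomputable def cc (V0 : ℝ) (N : ℕ) (k : ℤ) : AA N :=
  C (io (PowerSeries.X * PowerSeries.rescale (k : ℂ) Sser) * PowerSeries.C (tt V0 k)) * MvPolynomial.map cB (uu N k)

theorem cc_zero (V0 : ℝ) (N : ℕ) : cc V0 N 0 = C (io (PowerSeries.X * PowerSeries.C (V0 : ℂ))) := by
  have : PowerSeries.rescale (((0:ℤ)) : ℂ) Sser = 1 := by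
    ext n
    rw [PowerSeries.coeff_rescale, Sser, PowerSeries.coeff_mk, PowerSeries.coeff_one]
    rcases n with _ | n <;> simp
  rw [cc, this, tt, uu, dif_neg (lt_irrefl _), if_pos rfl, if_neg (lt_irrefl _), map_one, mul_one, map_mul,
    mul_one]
  simp [io]

theorem cc_pos (V0 : ℝ) (N : ℕ) (k : ℕ) (hk : k ≠ 0) : cc V0 N (k : ℤ) = C (PowerSeries.coeff k gam) := by
  obtain ⟨j, rfl⟩ : ∃ j : ℕ+, k = j := ⟨⟨k, Nat.pos_of_ne_zero hk⟩, rfl⟩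
  have h1 : tt V0 ((j:ℕ):ℤ) = X j := by
    rw [tt, dif_pos (by exact_mod_cast j.pos)]
    rfl
  rw [cc, h1, uu, if_neg (by omega), map_one, mul_one, Int.cast_natCast, io_zS _ hk, gam, map_sub,
    PowerSeries.coeff_rescale, PowerSeries.coeff_rescale, Tg, PowerSeries.coeff_map, coeff_genT]
  congr 1
  rw [MvPolynomial.smul_eq_C_mul, map_mul, ← sub_mul, ← mul_assoc]
  congr 1
  rw [mul_comm _ (PowerSeries.C _)]
  exact (cB_mul _ _).symm

theorem cc_neg (V0 : ℝ) (N : ℕ) (k : ℕ) (hk : k ≠ 0) : cc V0 N (-(k : ℤ)) = PowerSeries.coeff k (phi N) := by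
  have h1 : tt V0 (-(k:ℤ)) = 1 := by
    rw [tt, dif_neg (by omega), if_neg (by omega)]
  rw [cc, h1, uu, if_pos (by omega), map_one, mul_one, neg_neg, Int.toNat_natCast]
  push_cast
  rw [Sser_neg, io_zS _ hk, phi, map_sum, map_sum, Finset.mul_sum]
  refine Finset.sum_congr rfl fun i _ => ?_
  rw [map_sub, PowerSeries.coeff_rescale, PowerSeries.coeff_rescale, ← sub_mul, map_pow, map_X, mul_pow, mul_pow,
    ← sub_mul, mul_assoc, ell, PowerSeries.coeff_mk, ← cB_mul]
  have : algebraMap ℂ (AA N) ((k:ℂ)⁻¹) = C (cB ((k:ℂ)⁻¹)) := by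
    have h2 : cB ((k:ℂ)⁻¹) = algebraMap ℂ BB ((k:ℂ)⁻¹) := by
      rw [PowerSeries.algebraMap_apply]; rfl
    rw [h2, MvPolynomial.algebraMap_apply]
  rw [this]
  simp only [map_mul, map_sub, map_pow]
  ring

theorem uu_hom (N : ℕ) (k : ℤ) : (MvPolynomial.map cB (uu N k)).IsHomogeneous (-k).toNat := by
  rw [uu]
  split_ifs with h
  · refine MvPolynomial.IsHomogeneous.map ?_ _
    refine MvPolynomial.IsHomogeneous.sum _ _ _ fun i _ => ?_
    exact MvPolynomial.isHomogeneous_X_pow _ _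
  · have : (-k).toNat = 0 := by omega
    rw [this, map_one]
    exact MvPolynomial.isHomogeneous_one _ _

theorem cc_hom (V0 : ℝ) (N : ℕ) (k : ℤ) : (cc V0 N k).IsHomogeneous (-k).toNat := by
  have := (MvPolynomial.isHomogeneous_C (Fin N) (io (PowerSeries.X * PowerSeries.rescale (k : ℂ) Sser) * PowerSeries.C (tt V0 k))).mul (uu_hom N k)
  rwa [zero_add] at this

theorem cc_dvd (V0 : ℝ) (N : ℕ) (k : ℤ) : C (PowerSeries.X) ∣ cc V0 N k := by
  rw [cc, map_mul io, io, PowerSeries.map_X]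
  rw [map_mul C, map_mul C, mul_assoc, mul_assoc]
  exact Dvd.intro _ rfl

theorem foldr_pos (V0 : ℝ) (n : ℕ) (k : Fin n → ℤ) (f : RR) :
    ((List.ofFn fun i => if 0 ≤ k i then Vhat V0 (k i) else LinearMap.id).foldr
    (· ∘ₗ ·) LinearMap.id) f = (∏ i, tt V0 (k i)) * f := by
  induction n with
  | zero => simp
  | succ n ih =>
    rw [List.ofFn_succ, List.foldr_cons, LinearMap.comp_apply, ih (fun i => k i.succ), Fin.prod_univ_succ, mul_assoc]
    rw [tt, Vhat]
    rcases lt_trichotomy (k 0) 0 with h | h | h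
    · rw [if_neg (by omega), dif_neg (by omega), if_neg (by omega)]
      simp
    · rw [if_pos (by omega), dif_neg (by omega), dif_pos h, dif_neg (by omega), if_pos h]
      simp [MvPolynomial.smul_eq_C_mul]
    · rw [if_pos (by omega), dif_pos h, dif_pos h]
      rfl

theorem foldr_neg (V0 : ℝ) (n : ℕ) (k : Fin n → ℤ) {N : ℕ} (α : Fin N → ℕ) (P : MvPolynomial (Fin N) ℂ) :
    ((List.ofFn fun i => if k i < 0 then Vhat V0 (k i) else LinearMap.id).foldr
    (· ∘ₗ ·) LinearMap.id) (L0 α P) = L0 α ((∏ i, uu N (k i)) * P) := by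
  induction n with
  | zero => simp
  | succ n ih =>
    rw [List.ofFn_succ, List.foldr_cons, LinearMap.comp_apply, ih (fun i => k i.succ), Fin.prod_univ_succ, mul_assoc]
    rw [uu, Vhat]
    by_cases h : k 0 < 0
    · rw [if_pos h, dif_neg (by omega), dif_neg (by omega), if_pos h]
      have := L0_deriv α (⟨(-k 0).toNat, by omega⟩ : ℕ+) ((∏ i : Fin n, uu N (k i.succ)) * P)
      rw [PNat.mk_coe] at this
      rw [← this]
      have h2 : (-((k 0 : ℤ) : ℂ)) = (((-k 0).toNat : ℕ) : ℂ) := by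
        have : (((-k 0).toNat : ℕ) : ℤ) = - k 0 := by omega
        have h3 := congrArg (fun z : ℤ => (z : ℂ)) this
        simp only [Int.cast_natCast, Int.cast_neg] at h3
        exact h3.symm
      rw [h2]
      rfl
    · rw [if_neg h, if_neg h, one_mul]
      rfl

theorem normalOrd_L0 (V0 : ℝ) (n : ℕ) (k : Fin n → ℤ) {N : ℕ} (α : Fin N → ℕ) (P : MvPolynomial (Fin N) ℂ) :
    normalOrdV V0 n k (L0 α P) = (∏ i, tt V0 (k i)) * L0 α ((∏ i, uu N (k i)) * P) := by
  rw [normalOrdV, LinearMap.comp_apply, foldr_neg, foldr_pos]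

theorem term_eq (V0 : ℝ) (p n : ℕ) (k : Fin n → ℤ) {N : ℕ} (α : Fin N → ℕ) (P : MvPolynomial (Fin N) ℂ) :
    coefS p n k • normalOrdV V0 n k (L0 α P) =
      PowerSeries.coeff p (io (Sser⁻¹) * LL α ((((n.factorial : ℂ)⁻¹) • ∏ i, cc V0 N (k i)) * MvPolynomial.map cB P)) := by
  have h1 : ((((n.factorial : ℂ)⁻¹) • ∏ i, cc V0 N (k i)) * MvPolynomial.map cB P) =
      (cB ((n.factorial : ℂ)⁻¹) * (∏ i, io (PowerSeries.X * PowerSeries.rescale (k i : ℂ) Sser)) * PowerSeries.C (∏ i, tt V0 (k i))) •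
        MvPolynomial.map cB ((∏ i, uu N (k i)) * P) := by
    simp only [cc]
    rw [MvPolynomial.smul_eq_C_mul, Finset.prod_mul_distrib, ← map_prod C, Finset.prod_mul_distrib, map_mul (MvPolynomial.map cB),
      ← map_prod (MvPolynomial.map cB), ← map_prod PowerSeries.C]
    have h2 : ∀ x : AA N, ((n.factorial : ℂ)⁻¹) • x = C (cB ((n.factorial : ℂ)⁻¹)) * x := by
      intro x
      rw [← MvPolynomial.smul_eq_C_mul, ← mul_one (cB _), cB_mul, smul_assoc, one_smul]
    rw [h2]
    simp only [map_mul]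
    ring
  rw [h1, map_smul, LL_map, normalOrd_L0, smul_eq_mul]
  have h3 : io (Sser⁻¹) * (cB ((n.factorial : ℂ)⁻¹) * (∏ i, io (PowerSeries.X * PowerSeries.rescale (k i : ℂ) Sser)) * PowerSeries.C (∏ i, tt V0 (k i)) *
      PowerSeries.C (L0 α ((∏ i, uu N (k i)) * P))) =
      io (Sser⁻¹ * (PowerSeries.X ^ n * PowerSeries.C ((Nat.factorial n : ℂ)⁻¹)) *
      ∏ i : Fin n, PowerSeries.rescale ((k i : ℂ)) Sser) * PowerSeries.C ((∏ i, tt V0 (k i)) * L0 α ((∏ i, uu N (k i)) * P)) := by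
    have h4 : io (PowerSeries.C ((Nat.factorial n : ℂ)⁻¹)) = cB ((n.factorial : ℂ)⁻¹) := by
      simp [io, cB]
    rw [← map_prod, Finset.prod_mul_distrib, Finset.prod_const, Finset.card_univ, Fintype.card_fin]
    simp only [map_mul, h4]
    ring
  rw [h3, PowerSeries.coeff_mul_C, coefS, MvPolynomial.smul_eq_C_mul]
  congr 1


theorem vanish_box (V0 : ℝ) (n : ℕ) (k : Fin n → ℤ) {N : ℕ} (α : Fin N → ℕ) (P : MvPolynomial (Fin N) ℂ)
    (hk : ∑ i, k i = 0) (i : Fin n) (hi : ¬ (-(∑ j, α j : ℕ) ≤ k i ∧ k i ≤ (∑ j, α j : ℕ))) :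
    normalOrdV V0 n k (L0 α P) = 0 := by
  rw [normalOrd_L0]
  have h : PowerSeries.C (L0 α ((∏ i, uu N (k i)) * P)) = (0 : BB) := by
    rw [← LL_map, map_mul, map_prod]
    refine LL_vanish α _ _ (∑ i, (-(k i)).toNat) (MvPolynomial.IsHomogeneous.prod _ _ _ fun i _ => uu_hom N (k i)) ?_
    have e : ∑ i, (((-(k i)).toNat : ℕ) : ℤ) = ∑ i, (((k i).toNat : ℕ) : ℤ) := by
      rw [← sub_eq_zero, ← Finset.sum_sub_distrib]
      have : ∀ i, (((-(k i)).toNat : ℕ) : ℤ) - (((k i).toNat : ℕ) : ℤ) = - k i := fun i => by omega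
      rw [Finset.sum_congr rfl fun i _ => this i, Finset.sum_neg_distrib, hk, neg_zero]
    have e2 : ∑ i, (-(k i)).toNat = ∑ i, (k i).toNat := by exact_mod_cast e
    have l1 := Finset.single_le_sum (f := fun i => (-(k i)).toNat) (fun _ _ => Nat.zero_le _) (Finset.mem_univ i)
    have l2 := Finset.single_le_sum (f := fun i => (k i).toNat) (fun _ _ => Nat.zero_le _) (Finset.mem_univ i)
    omega
  have h0 : L0 α ((∏ i, uu N (k i)) * P) = 0 := PowerSeries.C_injective (by rw [h, map_zero])
  rw [h0, mul_zero]

theorem coefS_zero (p n : ℕ) (k : Fin n → ℤ) (h : p < n) : coefS p n k = 0 := by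
  rw [coefS]
  have : PowerSeries.X ^ n ∣ (Sser⁻¹ * (PowerSeries.X ^ n * PowerSeries.C ((Nat.factorial n : ℂ)⁻¹)) *
      ∏ i : Fin n, PowerSeries.rescale ((k i : ℂ)) Sser) :=
    Dvd.dvd.mul_right (Dvd.dvd.mul_left (Dvd.intro _ rfl) _) _
  exact PowerSeries.X_pow_dvd_iff.1 this p h

noncomputable def box (D n : ℕ) : Finset (Fin n → ℤ) :=
  Fintype.piFinset (fun _ => Finset.Icc (-(D:ℤ)) D)

noncomputable def WW {A : Type*} [CommRing A] [Algebra ℂ A] (c : ℤ → A) (D M : ℕ) : A :=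
  ∑ n ∈ Finset.range M, ∑ k ∈ box D n, if ∑ i, k i = 0 then ((n.factorial : ℂ)⁻¹) • ∏ i, c (k i) else 0

theorem Kop_eq (V0 : ℝ) (p M : ℕ) (hM : p < M) {N : ℕ} (α : Fin N → ℕ) (P : MvPolynomial (Fin N) ℂ) :
    Kop V0 p (L0 α P) = PowerSeries.coeff p (io (Sser⁻¹) *
      LL α (WW (cc V0 N) (∑ j, α j) M * MvPolynomial.map cB P)) := by
  rw [Kop, finsum_eq_sum_of_support_subset (s := Finset.range M)]
  · rw [WW, Finset.sum_mul, map_sum, Finset.mul_sum, map_sum]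
    refine Finset.sum_congr rfl fun n _ => ?_
    rw [finsum_eq_sum_of_support_subset (s := box (∑ j, α j) n)]
    · rw [Finset.sum_mul, map_sum, Finset.mul_sum, map_sum]
      refine Finset.sum_congr rfl fun k _ => ?_
      split_ifs with h
      · exact term_eq V0 p n k α P
      · simp
    · intro k hk
      by_contra h
      apply hk
      simp only [box, Finset.mem_coe, Fintype.mem_piFinset, Finset.mem_Icc, not_forall] at h
      obtain ⟨i, hi⟩ := h
      show (if ∑ i, k i = 0 then coefS p n k • normalOrdV V0 n k (L0 α P) else 0) = 0
      split_ifs with h0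
      · rw [vanish_box V0 n k α P h0 i hi, smul_zero]
      · rfl
  · intro n hn
    by_contra h
    apply hn
    simp only [Finset.coe_range, Set.mem_Iio, not_lt] at h
    simp only [coefS_zero p n _ (show p < n by omega), zero_smul, ite_self]
    exact finsum_zero

noncomputable def z0 {A : Type*} [CommRing A] : LaurentPolynomial A →ₗ[A] A :=
  Finsupp.lapply 0 ∘ₗ (AddMonoidAlgebra.coeffLinearEquiv A).toLinearMap

theorem z0_single {A : Type*} [CommRing A] (a : A) (n : ℤ) :
    z0 (LaurentPolynomial.C a * LaurentPolynomial.T n) = if n = 0 then a else 0 := by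
  rw [← LaurentPolynomial.single_eq_C_mul_T]
  show (AddMonoidAlgebra.single n a).coeff 0 = _
  rw [AddMonoidAlgebra.coeff_single, Finsupp.single_apply]

theorem z0_C_mul {A : Type*} [CommRing A] (a : A) (x : LaurentPolynomial A) :
    z0 (LaurentPolynomial.C a * x) = a * z0 x := by
  rw [← LaurentPolynomial.smul_eq_C_mul, map_smul, smul_eq_mul]

theorem z0_smul {A : Type*} [CommRing A] [Algebra ℂ A] (r : ℂ) (x : LaurentPolynomial A) :
    z0 (r • x) = r • z0 x := by
  rw [← algebraMap_smul A r x, map_smul, algebraMap_smul]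

theorem T_prod {A : Type*} [CommRing A] {n : ℕ} (k : Fin n → ℤ) :
    ∏ i, (LaurentPolynomial.T (k i) : LaurentPolynomial A) = LaurentPolynomial.T (∑ i, k i) := by
  induction n with
  | zero => simp
  | succ n ih => rw [Fin.prod_univ_succ, Fin.sum_univ_succ, ih, LaurentPolynomial.T_add]

theorem LP_WW {A : Type*} [CommRing A] [Algebra ℂ A] (c : ℤ → A) (D M : ℕ) :
    z0 (eT M (∑ k ∈ Finset.Icc (-(D:ℤ)) D, LaurentPolynomial.C (c k) * LaurentPolynomial.T k)) = WW c D M := by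
  rw [eT, map_sum, WW]
  refine Finset.sum_congr rfl fun n _ => ?_
  have h := Finset.prod_univ_sum (fun _ : Fin n => Finset.Icc (-(D:ℤ)) D)
    (fun _ k => LaurentPolynomial.C (c k) * LaurentPolynomial.T k)
  rw [Finset.prod_const, Finset.card_univ, Fintype.card_fin] at h
  rw [z0_smul, h, map_sum, Finset.smul_sum]
  refine Finset.sum_congr rfl fun k _ => ?_
  rw [Finset.prod_mul_distrib, T_prod, ← map_prod, z0_single]
  split_ifs
  · rfl
  · rw [smul_zero]

theorem LP_U {A : Type*} [CommRing A] (c : ℤ → A) (f g : PowerSeries A)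
    (hf : ∀ k : ℕ, k ≠ 0 → c k = PowerSeries.coeff k f) (hg : ∀ k : ℕ, k ≠ 0 → c (-k) = PowerSeries.coeff k g)
    (hf0 : PowerSeries.X ∣ f) (hg0 : PowerSeries.X ∣ g) (D : ℕ) :
    ∑ k ∈ Finset.Icc (-(D:ℤ)) D, LaurentPolynomial.C (c k) * LaurentPolynomial.T k =
      LaurentPolynomial.C (c 0) + (Polynomial.toLaurent (PowerSeries.trunc (D+1) f) +
        LaurentPolynomial.invert (Polynomial.toLaurent (PowerSeries.trunc (D+1) g))) := by
  induction D with
  | zero =>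
    rw [PowerSeries.X_dvd_iff, ← PowerSeries.coeff_zero_eq_constantCoeff_apply] at hf0 hg0
    rw [PowerSeries.trunc_succ, PowerSeries.trunc_succ, hf0, hg0]
    simp
  | succ D ih =>
    have : Finset.Icc (-((D+1:ℕ):ℤ)) ((D+1:ℕ):ℤ) = insert (((D+1:ℕ):ℤ)) (insert (-((D+1:ℕ):ℤ)) (Finset.Icc (-(D:ℤ)) D)) := by
      ext x
      simp only [Finset.mem_Icc, Finset.mem_insert]
      omega
    rw [this, Finset.sum_insert, Finset.sum_insert, ih, PowerSeries.trunc_succ _ (D+1), PowerSeries.trunc_succ _ (D+1),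
      hf _ (Nat.succ_ne_zero D), hg _ (Nat.succ_ne_zero D)]
    · rw [map_add, map_add, map_add, ← Polynomial.C_mul_X_pow_eq_monomial, ← Polynomial.C_mul_X_pow_eq_monomial,
        Polynomial.toLaurent_C_mul_X_pow, Polynomial.toLaurent_C_mul_X_pow, map_mul, LaurentPolynomial.invert_C, LaurentPolynomial.invert_T]
      ring
    · simp
    · simp only [Finset.mem_Icc, Finset.mem_insert]
      omega

theorem z0_mul {A : Type*} [CommRing A] (P Q : Polynomial A) (K : ℕ) (hP : P.natDegree < K) (hQ : Q.natDegree < K) :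
    z0 (Polynomial.toLaurent P * LaurentPolynomial.invert (Polynomial.toLaurent Q)) =
      ∑ a ∈ Finset.range K, P.coeff a * Q.coeff a := by
  have h : ∀ R : Polynomial A, R.natDegree < K → Polynomial.toLaurent R =
      ∑ a ∈ Finset.range K, LaurentPolynomial.C (R.coeff a) * LaurentPolynomial.T (a:ℤ) := by
    intro R hR
    conv_lhs => rw [Polynomial.as_sum_range' R K hR]
    rw [map_sum]
    refine Finset.sum_congr rfl fun a _ => ?_
    rw [← Polynomial.C_mul_X_pow_eq_monomial, Polynomial.toLaurent_C_mul_X_pow]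
  rw [h P hP, h Q hQ, map_sum, Finset.sum_mul_sum, map_sum]
  refine Finset.sum_congr rfl fun a ha => ?_
  rw [map_sum, Finset.sum_eq_single a]
  · rw [map_mul LaurentPolynomial.invert, LaurentPolynomial.invert_C, LaurentPolynomial.invert_T]
    have : LaurentPolynomial.C (P.coeff a) * LaurentPolynomial.T (a:ℤ) * (LaurentPolynomial.C (Q.coeff a) * LaurentPolynomial.T (-(a:ℤ)))
       = LaurentPolynomial.C (P.coeff a * Q.coeff a) * LaurentPolynomial.T ((a:ℤ) + -a) := by
      rw [map_mul, LaurentPolynomial.T_add]; ring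
    rw [this, z0_single, if_pos (by ring)]
  · intro b _ hb
    rw [map_mul LaurentPolynomial.invert, LaurentPolynomial.invert_C, LaurentPolynomial.invert_T]
    have : LaurentPolynomial.C (P.coeff a) * LaurentPolynomial.T (a:ℤ) * (LaurentPolynomial.C (Q.coeff b) * LaurentPolynomial.T (-(b:ℤ)))
       = LaurentPolynomial.C (P.coeff a * Q.coeff b) * LaurentPolynomial.T ((a:ℤ) + -b) := by
      rw [map_mul, LaurentPolynomial.T_add]; ring
    rw [this, z0_single, if_neg (by omega)]
  · intro h
    exact absurd ha h

theorem C_dvd_trunc {A : Type*} [CommRing A] (t : A) (f : PowerSeries A) (hf : ∀ k, t ∣ PowerSeries.coeff k f) (n : ℕ) :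
    Polynomial.C t ∣ PowerSeries.trunc n f := by
  rw [Polynomial.C_dvd_iff_dvd_coeff]
  intro i
  rw [PowerSeries.coeff_trunc]
  split_ifs
  · exact hf i
  · exact dvd_zero _

theorem WW_main {A : Type*} [CommRing A] [Algebra ℂ A] (c : ℤ → A) (f g : PowerSeries A) (t : A)
    (hf : ∀ k : ℕ, k ≠ 0 → c k = PowerSeries.coeff k f) (hg : ∀ k : ℕ, k ≠ 0 → c (-k) = PowerSeries.coeff k g)
    (hf0 : PowerSeries.X ∣ f) (hg0 : PowerSeries.X ∣ g) (ht : ∀ k, t ∣ c k) (D M : ℕ) :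
    ∃ K, D < K ∧ t ^ M ∣ eT M (c 0) * (∑ a ∈ Finset.range K, (eT M (PowerSeries.trunc (D+1) f)).coeff a *
      (eT M (PowerSeries.trunc (D+1) g)).coeff a) - WW c D M := by
  have hf' : ∀ k, t ∣ PowerSeries.coeff k f := by
    intro k
    by_cases h : k = 0
    · rw [PowerSeries.X_dvd_iff, ← PowerSeries.coeff_zero_eq_constantCoeff_apply] at hf0
      rw [h, hf0]; exact dvd_zero _
    · rw [← hf k h]; exact ht _
  have hg' : ∀ k, t ∣ PowerSeries.coeff k g := by
    intro k
    by_cases h : k = 0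
    · rw [PowerSeries.X_dvd_iff, ← PowerSeries.coeff_zero_eq_constantCoeff_apply] at hg0
      rw [h, hg0]; exact dvd_zero _
    · rw [← hg k h]; exact ht _
  set F := PowerSeries.trunc (D+1) f
  set G := PowerSeries.trunc (D+1) g
  refine ⟨max D (max (eT M F).natDegree (eT M G).natDegree) + 1, by omega, ?_⟩
  rw [← z0_mul _ _ _ (by omega) (by omega), ← LP_WW, LP_U c f g hf hg hf0 hg0, ← z0_C_mul, ← map_sub]
  have dF : LaurentPolynomial.C t ∣ Polynomial.toLaurent F := by
    rw [← Polynomial.toLaurent_C]; exact map_dvd _ (C_dvd_trunc t f hf' _)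
  have dG : LaurentPolynomial.C t ∣ LaurentPolynomial.invert (Polynomial.toLaurent G) := by
    rw [← LaurentPolynomial.invert_C, ← Polynomial.toLaurent_C]; exact map_dvd _ (map_dvd _ (C_dvd_trunc t g hg' _))
  have dC : LaurentPolynomial.C t ∣ LaurentPolynomial.C (c 0) := map_dvd _ (ht 0)
  have s1 : ∀ (r : ℂ) (x : Polynomial A), Polynomial.toLaurent (r • x) = r • Polynomial.toLaurent x := by
    intro r x
    rw [← algebraMap_smul A r x, ← algebraMap_smul A r (Polynomial.toLaurent x), Polynomial.smul_eq_C_mul, map_mul,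
      Polynomial.toLaurent_C, LaurentPolynomial.smul_eq_C_mul]
  have s2 : ∀ (r : ℂ) (x : LaurentPolynomial A), LaurentPolynomial.invert (r • x) = r • LaurentPolynomial.invert x := by
    intro r x
    rw [← algebraMap_smul A r x, ← algebraMap_smul A r (LaurentPolynomial.invert x), map_smul]
  have s3 : ∀ (r : ℂ) (x : A), LaurentPolynomial.C (r • x) = r • LaurentPolynomial.C x := by
    intro r x
    rw [← algebraMap_smul A r x, ← algebraMap_smul A r (LaurentPolynomial.C x), smul_eq_mul, map_mul, LaurentPolynomial.smul_eq_C_mul]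
  have r1 := fun x => eT_map (Polynomial.toLaurent (R := A)) s1 M x
  have r3 := eT_map (LaurentPolynomial.C (R := A)) s3 M (c 0)
  rw [r1, r1, r3]
  have := eT_map (LaurentPolynomial.invert (R := A)).toRingEquiv.toRingHom s2 M (Polynomial.toLaurent G)
  have this' : LaurentPolynomial.invert (eT M (Polynomial.toLaurent G)) = eT M (LaurentPolynomial.invert (Polynomial.toLaurent G)) := this
  rw [this']
  have k1 := eT_add _ _ _ dF dG M
  have k2 := eT_add _ _ _ dC (dvd_add dF dG) M
  have k3 := dvd_add (Dvd.dvd.mul_left k1 (eT M (LaurentPolynomial.C (c 0)))) k2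
  rw [mul_sub, sub_add_sub_cancel, ← map_pow] at k3
  obtain ⟨y, hy⟩ := k3
  rw [hy, z0_C_mul]
  exact Dvd.intro _ rfl

theorem trunc_coeff {A : Type*} [CommRing A] [Algebra ℂ A] (f : PowerSeries A) (hf : PowerSeries.X ∣ f) (D M a : ℕ)
    (ha : a ≤ D) (hM : D < M) :
    (eT M (PowerSeries.trunc (D+1) f)).coeff a = PowerSeries.coeff a (eS f) := by
  rw [eS_coeff f hf (show a < M by omega), ← Polynomial.coeff_coe]
  have h : ((eT M (PowerSeries.trunc (D+1) f) : Polynomial A) : PowerSeries A) = eT M ((PowerSeries.trunc (D+1) f : Polynomial A) : PowerSeries A) := by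
    refine eT_map (Polynomial.coeToPowerSeries.ringHom (R := A)) ?_ M _
    intro r x
    ext n
    simp [Polynomial.coeff_coe]
  rw [h]
  refine coeff_eq_of_dvd (M := D+1) ?_ (by omega)
  refine eT_dvd _ _ _ ?_ M
  rw [PowerSeries.X_pow_dvd_iff]
  intro m hm
  rw [map_sub, Polynomial.coeff_coe, PowerSeries.coeff_trunc, if_pos hm, sub_self]

theorem hom_mul {N : ℕ} (P Q : Polynomial (AA N)) (hP : ∀ a, (P.coeff a).IsHomogeneous a) (hQ : ∀ a, (Q.coeff a).IsHomogeneous a) (a : ℕ) :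
    ((P * Q).coeff a).IsHomogeneous a := by
  rw [Polynomial.coeff_mul]
  refine MvPolynomial.IsHomogeneous.sum _ _ _ fun p hp => ?_
  rw [Finset.HasAntidiagonal.mem_antidiagonal] at hp
  rw [← hp]
  exact (hP _).mul (hQ _)

theorem hom_pow {N : ℕ} (P : Polynomial (AA N)) (hP : ∀ a, (P.coeff a).IsHomogeneous a) (n : ℕ) :
    ∀ a, ((P ^ n).coeff a).IsHomogeneous a := by
  induction n with
  | zero =>
    intro a
    rw [pow_zero, Polynomial.coeff_one]
    split_ifs with h
    · rw [h]; exact MvPolynomial.isHomogeneous_one _ _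
    · exact MvPolynomial.isHomogeneous_zero _ _ _
  | succ n ih => rw [pow_succ]; exact hom_mul _ _ ih hP

theorem hom_eT {N : ℕ} (P : Polynomial (AA N)) (hP : ∀ a, (P.coeff a).IsHomogeneous a) (M a : ℕ) :
    ((eT M P).coeff a).IsHomogeneous a := by
  rw [eT, Polynomial.finsetSum_coeff]
  refine MvPolynomial.IsHomogeneous.sum _ _ _ fun n _ => ?_
  rw [Polynomial.coeff_smul, ← algebraMap_smul BB, MvPolynomial.smul_eq_C_mul]
  have := (MvPolynomial.isHomogeneous_C (Fin N) (algebraMap ℂ BB ((n.factorial : ℂ)⁻¹))).mul (hom_pow P hP n a)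
  rwa [zero_add] at this

theorem phi_hom (V0 : ℝ) (N k : ℕ) : (PowerSeries.coeff k (phi N)).IsHomogeneous k := by
  by_cases h : k = 0
  · have := X_dvd_phi N
    rw [PowerSeries.X_dvd_iff, ← PowerSeries.coeff_zero_eq_constantCoeff_apply] at this
    rw [h, this]
    exact MvPolynomial.isHomogeneous_zero _ _ _
  · rw [← cc_neg V0 N k h]
    have := cc_hom V0 N (-(k:ℤ))
    rwa [neg_neg, Int.toNat_natCast] at this

theorem LL_smul_C {N : ℕ} (α : Fin N → ℕ) (b : BB) (x : AA N) : LL α (C b * x) = b * LL α x := by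
  rw [← MvPolynomial.smul_eq_C_mul, map_smul, smul_eq_mul]

theorem LL_W (V0 : ℝ) {N : ℕ} (α : Fin N → ℕ) (M : ℕ) (hM : ∑ j, α j < M) (P : AA N) :
    PowerSeries.X ^ M ∣ eT M (io (PowerSeries.X * PowerSeries.C (V0:ℂ))) * (∑ a ∈ Finset.range (∑ j, α j + 1),
      PowerSeries.coeff a (eS gam) * LL α (PowerSeries.coeff a (eS (phi N)) * P)) -
      LL α (WW (cc V0 N) (∑ j, α j) M * P) := by
  set D := ∑ j, α j with hD
  have X0 : PowerSeries.X ∣ PowerSeries.map (C (σ := Fin N)) gam := by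
    have := map_dvd (PowerSeries.map (C (σ := Fin N) (R := BB))) X_dvd_gam
    rwa [PowerSeries.map_X] at this
  obtain ⟨K, hK, y, hy⟩ := WW_main (cc V0 N) (PowerSeries.map C gam) (phi N) (C PowerSeries.X)
    (fun k hk => by rw [cc_pos V0 N k hk, PowerSeries.coeff_map]) (fun k hk => cc_neg V0 N k hk)
    X0 (X_dvd_phi N) (cc_dvd V0 N) D M
  have hc0 : eT M (cc V0 N 0) = C (eT M (io (PowerSeries.X * PowerSeries.C (V0:ℂ)))) := by
    rw [cc_zero]
    refine (eT_map (C (σ := Fin N) (R := BB)) ?_ M _).symm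
    intro r x
    rw [MvPolynomial.C_eq_smul_one, smul_assoc, ← MvPolynomial.C_eq_smul_one]
  have hg : ∀ a ≤ D, (eT M (PowerSeries.trunc (D+1) (PowerSeries.map (C (σ := Fin N)) gam))).coeff a =
      C (PowerSeries.coeff a (eS gam)) := by
    intro a ha
    rw [trunc_coeff _ X0 D M a ha hM, ← PowerSeries.coeff_map, eS_map]
    intro r x
    rw [MvPolynomial.C_eq_smul_one, smul_assoc, ← MvPolynomial.C_eq_smul_one]
  have key : LL α ((eT M (cc V0 N 0) * ∑ a ∈ Finset.range K,
      (eT M (PowerSeries.trunc (D + 1) (PowerSeries.map (C (σ := Fin N)) gam))).coeff a * (eT M (PowerSeries.trunc (D + 1) (phi N))).coeff a) * P)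
      = eT M (io (PowerSeries.X * PowerSeries.C (V0:ℂ))) * (∑ a ∈ Finset.range (D + 1),
      PowerSeries.coeff a (eS gam) * LL α (PowerSeries.coeff a (eS (phi N)) * P)) := by
    rw [hc0, mul_assoc, LL_smul_C, Finset.sum_mul, map_sum]
    congr 1
    rw [← Finset.sum_subset (Finset.range_mono (show D + 1 ≤ K by omega))]
    · refine Finset.sum_congr rfl fun a ha => ?_
      have ha' : a ≤ D := by simp at ha; omega
      rw [hg a ha', trunc_coeff _ (X_dvd_phi N) D M a ha' hM, mul_assoc, LL_smul_C]
    · intro a _ ha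
      have ha' : D < a := by simp at ha; omega
      rw [mul_comm (Polynomial.coeff _ a), mul_assoc]
      refine LL_vanish α _ _ a (hom_eT _ (fun b => ?_) M a) ha'
      rw [PowerSeries.coeff_trunc]
      split_ifs
      · exact phi_hom V0 N b
      · exact MvPolynomial.isHomogeneous_zero _ _ _
  rw [← key, ← map_sub, ← sub_mul, hy, ← map_pow C, mul_assoc, LL_smul_C]
  exact Dvd.intro _ rfl


theorem gh_sum (n D : ℕ) (h : n ≤ D) : ∑ a ∈ Finset.range (D+1), PowerSeries.coeff a (eS gam) * rho ^ a *
    PowerSeries.C (hsymZ ((n:ℤ) - a)) = rho ^ (2 * n) * PowerSeries.C (hsymZ n) := by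
  rw [← Finset.sum_subset (Finset.range_mono (show n + 1 ≤ D + 1 by omega))]
  · have := congrArg (fun x => rho ^ n * PowerSeries.coeff n x) eS_gam
    simp only [PowerSeries.coeff_mul, PowerSeries.coeff_rescale, eS_Tg_coeff] at this
    rw [hsymZ_nat, two_mul, pow_add, mul_assoc, ← this, Finset.Nat.sum_antidiagonal_eq_sum_range_succ_mk, Finset.mul_sum]
    refine Finset.sum_congr rfl fun a ha => ?_
    have ha' : a ≤ n := by simp at ha; omega
    have e : ((n:ℤ) - a) = ((n - a : ℕ) : ℤ) := by omega
    rw [e, hsymZ_nat]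
    have e2 : rho ^ n = rho ^ a * rho ^ (n - a) := by rw [← pow_add]; congr 1; omega
    have e3 : rho ^ (n-a) * rho' ^ (n-a) = 1 := by rw [← mul_pow, rho_mul, one_pow]
    rw [e2]
    simp only
    linear_combination (-(PowerSeries.coeff a (eS gam) * rho ^ a * PowerSeries.C (hsym (n-a)))) * e3
  · intro a _ ha
    have ha' : n < a := by simp at ha; omega
    rw [hsymZ_neg (by omega), map_zero, mul_zero]

noncomputable def tau {N : ℕ} (i : Fin N) : AA N →ₐ[BB] AA N :=
  aeval (Function.update X i (C rho ^ 2 * X i))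

theorem tau_monomial {N : ℕ} (i : Fin N) (β : Fin N →₀ ℕ) (r : BB) :
    tau i (monomial β r) = C (rho ^ (2 * β i)) * monomial β r := by
  rw [tau, aeval_monomial, monomial_eq, Finsupp.prod_fintype _ _ (by simp), Finsupp.prod_fintype _ _ (by simp),
    ← Finset.mul_prod_erase Finset.univ _ (Finset.mem_univ i), ← Finset.mul_prod_erase Finset.univ _ (Finset.mem_univ i),
    Function.update_self, mul_pow, ← pow_mul, map_pow]
  have : ∏ x ∈ Finset.univ.erase i, Function.update X i (C rho ^ 2 * X i) x ^ β x = ∏ x ∈ Finset.univ.erase i, (X x : AA N) ^ β x := by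
    refine Finset.prod_congr rfl fun j hj => ?_
    rw [Function.update_of_ne (Finset.ne_of_mem_erase hj)]
  rw [this]
  have : algebraMap BB (AA N) r = C r := rfl
  rw [this]
  ring

theorem tau_vdm {N : ℕ} (i : Fin N) : tau i (vdm (X : Fin N → AA N)) = vdm (Function.update X i (C rho ^ 2 * X i)) := by
  rw [vdm, vdm, AlgHom.map_det]
  congr 1
  ext1 a b
  simp [tau]

theorem LL_tau {N : ℕ} (α : Fin N → ℕ) (i : Fin N) (P : AA N) :
    ∑ a ∈ Finset.range (∑ j, α j + 1), PowerSeries.coeff a (eS gam) * rho ^ a * LL α (X i ^ a * tau i P) =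
      rho ^ (2 * α i) * LL α P := by
  induction P using MvPolynomial.induction_on' with
  | add p q hp hq =>
    simp only [map_add, mul_add, Finset.sum_add_distrib, hp, hq]
  | monomial β r =>
    have hm : ∀ a : ℕ, LL α (X i ^ a * tau i (monomial β r)) = rho ^ (2 * β i) * r * (PowerSeries.C (hsymZ ((α i : ℤ) - β i - a)) *
        PowerSeries.C (∏ j ∈ Finset.univ.erase i, hsymZ ((α j : ℤ) - β j))) := by
      intro a
      rw [tau_monomial, mul_left_comm, LL_smul_C, X_pow_eq_monomial, monomial_mul, LL_monomial, one_mul, mul_assoc, hh,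
        ← Finset.mul_prod_erase Finset.univ _ (Finset.mem_univ i), map_mul]
      congr 4
      · simp; ring_nf
      · refine Finset.prod_congr rfl fun j hj => ?_
        have := Finset.ne_of_mem_erase hj
        simp [this.symm]
    simp only [hm]
    rw [LL_monomial, hh, ← Finset.mul_prod_erase Finset.univ _ (Finset.mem_univ i), map_mul]
    rcases lt_or_ge (α i) (β i) with h | h
    · rw [hsymZ_neg (show (α i : ℤ) - β i < 0 by omega)]
      rw [map_zero, zero_mul, mul_zero, mul_zero]
      refine Finset.sum_eq_zero fun a _ => ?_
      rw [hsymZ_neg (by omega), map_zero]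
      ring
    · have e : (α i : ℤ) - β i = ((α i - β i : ℕ) : ℤ) := by omega
      have hle : α i ≤ ∑ j, α j := Finset.single_le_sum (f := α) (fun _ _ => Nat.zero_le _) (Finset.mem_univ i)
      have := gh_sum (α i - β i) (∑ j, α j) (by omega)
      rw [e]
      have e2 : rho ^ (2 * α i) = rho ^ (2 * (α i - β i)) * rho ^ (2 * β i) := by
        rw [← pow_add]; congr 1; omega
      rw [e2]
      have e3 : ∀ x y : BB, rho ^ (2 * (α i - β i)) * rho ^ (2 * β i) * (r * (x * y)) = 
        (rho ^ (2 * (α i - β i)) * x) * (rho ^ (2 * β i) * r * y) := by intros; ring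
      rw [e3, ← this, Finset.sum_mul]
      refine Finset.sum_congr rfl fun a _ => ?_
      ring

theorem g_zero : PowerSeries.coeff 0 (eS gam) = 1 := by
  rw [eS_coeff gam X_dvd_gam (show 0 < 1 by omega), eT]
  simp

theorem main_sum {N : ℕ} (α : Fin N → ℕ) :
    rho ^ (2 * N) * ∑ a ∈ Finset.range (∑ j, α j + 1),
      PowerSeries.coeff a (eS gam) * LL α (PowerSeries.coeff a (eS (phi N)) * vdm X) =
    (1 + (rho ^ 2 - 1) * ∑ i, rho ^ (2 * α i)) * LL α (vdm X) := by
  have hr : (C rho : AA N) * C rho' = 1 := by rw [← map_mul, rho_mul, map_one]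
  have hg := gen_id (X : Fin N → AA N) (MvPolynomial.X_injective) (fun i => MvPolynomial.X_ne_zero i) (C rho) (C rho') hr
    (eS (phi N)) (eS_phi N)
  have h1 : ∀ a, rho ^ (2 * N) * LL α (PowerSeries.coeff a (eS (phi N)) * vdm X) =
      (if a = 0 then LL α (vdm X) else 0) + (rho ^ 2 - 1) * ∑ i, rho ^ a * LL α (X i ^ a * tau i (vdm X)) := by
    intro a
    have := congrArg (LL α) (hg a)
    rw [← map_pow, LL_smul_C, mul_comm (vdm _)] at this
    rw [this, map_add, apply_ite (LL α), map_zero]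
    congr 1
    have e : (C rho : AA N) ^ 2 - 1 = C (rho ^ 2 - 1) := by simp
    rw [e, LL_smul_C, map_sum]
    congr 1
    refine Finset.sum_congr rfl fun i _ => ?_
    rw [← map_pow, LL_smul_C, tau_vdm]
  rw [Finset.mul_sum]
  have h2 : ∀ a ∈ Finset.range (∑ j, α j + 1), rho ^ (2 * N) * (PowerSeries.coeff a (eS gam) * LL α (PowerSeries.coeff a (eS (phi N)) * vdm X)) =
    (if a = 0 then PowerSeries.coeff a (eS gam) * LL α (vdm X) else 0) + (rho ^ 2 - 1) * ∑ i, PowerSeries.coeff a (eS gam) * rho ^ a * LL α (X i ^ a * tau i (vdm X)) := by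
    intro a _
    rw [mul_left_comm, h1, mul_add, mul_ite, mul_zero, mul_left_comm, Finset.mul_sum]
    simp only [mul_assoc]
  rw [Finset.sum_congr rfl h2, Finset.sum_add_distrib, Finset.sum_ite_eq' , if_pos (by simp), g_zero, ← Finset.mul_sum,
    Finset.sum_comm, Finset.sum_congr rfl fun i _ => LL_tau α i (vdm X), ← Finset.sum_mul]
  ring

theorem vdm_map (N : ℕ) : MvPolynomial.map cB (vdm (X : Fin N → MvPolynomial (Fin N) ℂ)) = vdm (X : Fin N → AA N) := by
  rw [vdm, vdm, RingHom.map_det]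
  congr 1
  ext1 a b
  simp


theorem parts_zero (lam : Ptn) (i : ℕ) (h : lam.len ≤ i) : lam.parts i = 0 := by
  by_contra hne
  obtain ⟨K, hK⟩ := lam.eventually_zero
  have hfin : {j : ℕ | lam.parts j ≠ 0}.Finite := by
    refine (Set.finite_lt_nat K).subset fun j hj => ?_
    by_contra hc
    exact hj (hK j (not_lt.1 hc))
  have hsub : ((Finset.range (i+1) : Finset ℕ) : Set ℕ) ⊆ {j : ℕ | lam.parts j ≠ 0} := by
    intro j hj
    have hj' : j ≤ i := by simp at hj; omega
    have := lam.antitone hj'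
    simp only [Set.mem_ofPred_eq]
    omega
  have := Set.ncard_le_ncard hsub hfin
  rw [Set.ncard_coe_finset, Finset.card_range] at this
  rw [Ptn.len] at h
  omega

noncomputable def Qs (lam : Ptn) : PowerSeries ℂ := PowerSeries.mk fun j => ((Qfn j lam : ℚ) : ℂ)

noncomputable def bs : PowerSeries ℂ :=
  (2:ℂ) • PowerSeries.rescale (1/2 : ℂ) (bernoulliPowerSeries ℂ) - bernoulliPowerSeries ℂ

theorem ee_one : ee 1 = PowerSeries.exp ℂ := by simp [ee]

theorem XS : PowerSeries.X * Sser = ee (1/2) - ee (-1/2) := by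
  have := zS 1 one_ne_zero
  simpa using this

theorem bs_eq : bs * (ee (1/2) - ee (-1/2)) = PowerSeries.X := by
  have h1 := bernoulliPowerSeries_mul_exp_sub_one ℂ
  have h2 := congrArg (PowerSeries.rescale (1/2 : ℂ)) h1
  rw [map_mul, map_sub, map_one, PowerSeries.rescale_X] at h2
  rw [← ee_one] at h1
  change _ * (ee (1/2) - 1) = _ at h2
  have e1 : ee (1/2) * ee (1/2) = ee 1 := by rw [ee_add]; norm_num
  have e2 : ee (1/2) * ee (-1/2) = 1 := by rw [ee_add, ← ee_zero]; norm_num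
  have c2 : PowerSeries.C (2:ℂ) * PowerSeries.C (1/2:ℂ) = 1 := by rw [← map_mul]; norm_num
  rw [bs, PowerSeries.smul_eq_C_mul]
  set R := PowerSeries.rescale (1/2 : ℂ) (bernoulliPowerSeries ℂ)
  set B := bernoulliPowerSeries ℂ
  have e3 : ee (1/2) - ee (-1/2) = ee (-1/2) * (ee 1 - 1) := by linear_combination (ee (-1/2)) * e1 - (ee (1/2)) * e2
  rw [← e1] at h1 e3
  linear_combination (PowerSeries.C 2 * R - B) * e3 + ee (-1/2) * PowerSeries.C 2 * (ee (1/2) + 1) * h2 +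
    ee (-1/2) * (ee (1/2) + 1) * PowerSeries.X * c2 - ee (-1/2) * h1 + PowerSeries.X * e2

theorem bs_coeff (j : ℕ) : PowerSeries.coeff j bs = ((((2 : ℚ) ^ ((1 : ℤ) - (j : ℤ)) - 1) * bernoulli j / (Nat.factorial j : ℚ) : ℚ) : ℂ) := by
  rw [bs, map_sub, PowerSeries.coeff_smul, PowerSeries.coeff_rescale, bernoulliPowerSeries, PowerSeries.coeff_mk]
  rw [zpow_sub₀ two_ne_zero]
  simp
  ring

theorem Qs_eq (lam : Ptn) : Qs lam = bs + PowerSeries.X * ∑ i : Fin lam.len,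
    (ee ((lam.parts i : ℂ) - i - 1/2) - ee (-(i:ℂ) - 1/2)) := by
  ext j
  rw [Qs, PowerSeries.coeff_mk, map_add, bs_coeff, Qfn]
  rcases j with _ | j
  · simp; norm_num
  · rw [if_neg (Nat.succ_ne_zero j), PowerSeries.coeff_succ_X_mul, add_comm]
    rw [Rat.cast_add]
    congr 1
    rw [Nat.add_sub_cancel, Pfn, finsum_eq_sum_of_support_subset (s := Finset.range lam.len)]
    · rw [map_sum, Finset.sum_range, Finset.sum_div, Rat.cast_sum]
      refine Finset.sum_congr rfl fun i _ => ?_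
      rw [map_sub, ee_coeff, ee_coeff]
      push_cast
      rw [sub_div, div_eq_mul_inv, div_eq_mul_inv]
      congr 3
      · ring_nf
      · ring_nf
    · intro i hi
      by_contra h
      apply hi
      have := parts_zero lam i (by simpa using h)
      simp [this]

theorem scalar_id (lam : Ptn) (α : Fin lam.len → ℕ) (hα : ∀ i, α i = lam.parts i + (lam.len-1-(i:ℕ))) :
    Sser * Qs lam * ee lam.len = 1 + (ee 1 - 1) * ∑ i, ee (α i) := by
  have hX : (PowerSeries.X : PowerSeries ℂ) ≠ 0 := PowerSeries.X_ne_zero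
  apply mul_left_cancel₀ hX
  have e1 : PowerSeries.X * (Sser * Qs lam * ee lam.len) = (PowerSeries.X * Sser) * Qs lam * ee lam.len := by ring
  rw [e1, XS, Qs_eq]
  have h1 : ∀ i : Fin lam.len, (ee (1/2) - ee (-1/2)) * (ee ((lam.parts i : ℂ) - i - 1/2) - ee (-(i:ℂ) - 1/2)) * ee lam.len =
      (ee 1 - 1) * ee (α i) - (ee 1 - 1) * ee 1 ^ (lam.len - 1 - (i:ℕ)) := by
    intro i
    have hi := i.2
    have c1 : ((lam.len - 1 - (i:ℕ) : ℕ) : ℂ) = lam.len - 1 - i := by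
      rw [Nat.sub_sub, Nat.cast_sub (by omega)]; push_cast; ring
    rw [ee_pow, c1, hα i]
    push_cast
    rw [c1, sub_mul, mul_sub, mul_sub]
    simp only [sub_mul, ee_add, one_mul]
    have a1 : (1/2 + ((lam.parts i : ℂ) - i - 1/2) + lam.len : ℂ) = 1 + (lam.parts i + (lam.len - 1 - i)) := by ring
    have a2 : (1/2 + (-(i:ℂ) - 1/2) + lam.len : ℂ) = 1 + (lam.len - 1 - i) * 1 := by ring
    have a3 : (-1/2 + ((lam.parts i : ℂ) - i - 1/2) + lam.len : ℂ) = (lam.parts i + (lam.len - 1 - i)) := by ring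
    have a4 : (-1/2 + (-(i:ℂ) - 1/2) + lam.len : ℂ) = (lam.len - 1 - i) * 1 := by ring
    rw [a1, a2, a3, a4]
    ring
  have h2 : (ee 1 - 1) * ∑ i : Fin lam.len, ee 1 ^ (lam.len - 1 - (i:ℕ)) = ee lam.len - 1 := by
    rw [← Finset.sum_range (fun i => ee 1 ^ (lam.len - 1 - i)), Finset.sum_range_reflect (fun i => ee 1 ^ i), mul_geom_sum, ee_pow, mul_one]
  have h3 : (ee (1/2) - ee (-1/2)) * (∑ i : Fin lam.len, (ee ((lam.parts i : ℂ) - i - 1/2) - ee (-(i:ℂ) - 1/2))) * ee lam.len =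
      (ee 1 - 1) * ∑ i, ee (α i) - (ee lam.len - 1) := by
    rw [← h2, Finset.mul_sum, Finset.sum_mul, Finset.sum_congr rfl fun i _ => h1 i, Finset.sum_sub_distrib, Finset.mul_sum, Finset.mul_sum]
  linear_combination (ee lam.len) * bs_eq + PowerSeries.X * h3

theorem final (V0 : ℝ) (lam : Ptn) (p : ℕ) :
    Kop V0 p (schur lam) =
      (∑ j ∈ Finset.range (p + 1),
        (V0 : ℂ) ^ (p - j) * ((Qfn j lam : ℚ) : ℂ) / (Nat.factorial (p - j) : ℂ)) • schur lam := by
  obtain ⟨α, hα⟩ : ∃ α : Fin lam.len → ℕ, ∀ i, α i = lam.parts i + (lam.len-1-(i:ℕ)) := ⟨_, fun _ => rfl⟩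
  obtain ⟨M, hM1, hM2⟩ : ∃ M, p < M ∧ ∑ j, α j < M := ⟨p + ∑ j, α j + 1, by omega, by omega⟩
  rw [← L0_schur lam α hα, Kop_eq V0 p M hM1 α, vdm_map]
  have h1 := Dvd.dvd.mul_left (LL_W V0 α M hM2 (vdm X)) (io Sser⁻¹)
  rw [mul_sub] at h1
  rw [← coeff_eq_of_dvd h1 hM1]
  have h2 := main_sum α
  rw [← vdm_map, LL_map] at h2
  have h3 := congrArg io (scalar_id lam α hα)
  have r2 : ∀ n : ℕ, rho ^ (2 * n) = io (ee n) := by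
    intro n
    rw [rho, ← map_pow, ee_pow]
    congr 2; push_cast; ring_nf
  have r1 : rho ^ 2 = io (ee 1) := by
    have := r2 1
    simpa using this
  have h4 : 1 + (rho ^ 2 - 1) * ∑ i, rho ^ (2 * α i) = io (Sser * Qs lam) * io (ee lam.len) := by
    rw [← map_mul, h3, map_add, map_mul, map_sub, map_sum, map_one, r1]
    simp only [r2]
  rw [h4, r2] at h2
  have hu : io (ee (-lam.len)) * io (ee lam.len) = 1 := by
    rw [← map_mul, ee_add, neg_add_cancel, ee_zero, map_one]
  rw [vdm_map] at h2
  have h5 := congrArg (fun x => io (ee (-lam.len)) * x) h2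
  simp only [← mul_assoc, hu, one_mul] at h5
  have hS : io (Sser⁻¹) * io Sser = 1 := by
    rw [← map_mul, PowerSeries.inv_mul_cancel, map_one]
    rw [← PowerSeries.coeff_zero_eq_constantCoeff_apply, Sser, PowerSeries.coeff_mk]
    simp
  have hE : eT M (io (PowerSeries.X * PowerSeries.C (V0:ℂ))) = io (eT M (PowerSeries.X * PowerSeries.C (V0:ℂ))) :=
    (eT_map io io_smul M _).symm
  have h6 : io (Sser⁻¹) * (io (eT M (PowerSeries.X * PowerSeries.C (V0:ℂ))) * (io (ee (-lam.len)) * io (Sser * Qs lam) * io (ee lam.len) *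
      PowerSeries.C (L0 α (vdm X)))) = io (eT M (PowerSeries.X * PowerSeries.C (V0:ℂ)) * Qs lam) * PowerSeries.C (L0 α (vdm X)) := by
    rw [map_mul io Sser, map_mul io _ (Qs lam)]
    linear_combination (io (eT M (PowerSeries.X * PowerSeries.C (V0:ℂ))) * io (Qs lam) * PowerSeries.C (L0 α (vdm X))) *
      (io (ee (-lam.len)) * io (ee lam.len) * hS + hu)
  rw [h5, hE, h6, PowerSeries.coeff_mul_C, MvPolynomial.smul_eq_C_mul]
  congr 1
  have h7 : ∀ x, PowerSeries.coeff p (io x) = C (PowerSeries.coeff p x) := fun x => by rw [io, PowerSeries.coeff_map]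
  rw [h7]
  congr 1
  have h8 : ∀ a ≤ p, PowerSeries.coeff a (eT M (PowerSeries.X * PowerSeries.C (V0:ℂ))) = (V0:ℂ) ^ a * ((a.factorial : ℂ)⁻¹) := by
    intro a ha
    rw [eT, map_sum, Finset.sum_eq_single a]
    · rw [PowerSeries.coeff_smul, mul_pow, ← map_pow, PowerSeries.coeff_mul_C, PowerSeries.coeff_X_pow, if_pos rfl]
      simp [mul_comm]
    · intro b _ hb
      rw [PowerSeries.coeff_smul, mul_pow, ← map_pow, PowerSeries.coeff_mul_C, PowerSeries.coeff_X_pow, if_neg hb.symm]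
      simp
    · intro h
      simp at h
      omega
  rw [mul_comm, PowerSeries.coeff_mul, Finset.Nat.sum_antidiagonal_eq_sum_range_succ_mk]
  refine Finset.sum_congr rfl fun j _ => ?_
  simp only
  rw [h8 _ (Nat.sub_le _ _), Qs, PowerSeries.coeff_mk]
  ring

/-- Dubrovin's spectral theorem for the quantum dispersionless KdV hierarchy:
for every partition `λ` and every `m ≥ −1`,
`K_m^{[0]} s_λ(T) = (Σ_{j=0}^{m+2} V_0^{m+2−j} Q_j(λ)/(m+2−j)!) s_λ(T)`. -/
theorem statement4 (V0 : ℝ) (lam : Ptn) (m : ℤ) (hm : -1 ≤ m) :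
    Kop V0 (m + 2).toNat (schur lam) =
      (∑ j ∈ Finset.range ((m + 2).toNat + 1),
        (V0 : ℂ) ^ ((m + 2).toNat - j) * ((Qfn j lam : ℚ) : ℂ) /
          (Nat.factorial ((m + 2).toNat - j) : ℂ)) • schur lam := by
  exact final V0 lam (m + 2).toNat
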